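/- arXiv:1912.11444 — 5 statements merged into one kernel-verified Lean document; each statement's English description precedes it below -/
import Mathlib

section
/- Let q ≥ 1 and n ≥ 2 be integers and let X be a connected (q+1)-regular simple undirected graph on n vertices. If there exists an even integer k ≥ 2 with H_k ≥ 0, then μ(X) ≤ 1 + (4n − 7)^{1/k}. -/
open Matrix Filter

noncomputable section

/-- The non-backtracking (Hashimoto) matrix of a graph, indexed by darts:
`W e f = 1` if the end of `e` is the start of `f` and `f` is not the reversal of `e`. -/
def hashimoto {n : ℕ} (X : SimpleGraph (Fin n)) [DecidableRel X.Adj] :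
    Matrix X.Dart X.Dart ℝ :=
  Matrix.of fun e f => if e.toProd.2 = f.toProd.1 ∧ f ≠ e.symm then 1 else 0

/-- `N_k = trace(W^k)`, the number of geodesic cycles of length `k`. -/
def Ngc {n : ℕ} (X : SimpleGraph (Fin n)) [DecidableRel X.Adj] (k : ℕ) : ℝ :=
  (hashimoto X ^ k).trace

/-- The sequence `H_k`. -/
def Hseq (q : ℕ) {n : ℕ} (X : SimpleGraph (Fin n)) [DecidableRel X.Adj] (k : ℕ) : ℝ :=
  if Odd k then
    2 * ((n : ℝ) - 1) + Real.sqrt q ^ k + (Real.sqrt q ^ k)⁻¹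
      - (Real.sqrt q ^ k)⁻¹ * Ngc X k
  else
    2 * ((n : ℝ) - 1) + Real.sqrt q ^ k + (Real.sqrt q ^ k)⁻¹
      - (Real.sqrt q ^ k)⁻¹ * (Ngc X k - (n : ℝ) * ((q : ℝ) - 1))

/-- `μ(X) = q^{-1/2} · max_{2 ≤ i ≤ n} |λ_i|`, where `lam` enumerates the eigenvalues
in decreasing order (indices starting from `0`). -/
def mu (q : ℕ) {n : ℕ} (lam : Fin n → ℝ) : ℝ :=
  (Real.sqrt q)⁻¹ * sSup {x : ℝ | ∃ i : Fin n, (i : ℕ) ≠ 0 ∧ x = |lam i|}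

namespace NonBacktracking

open Polynomial

lemma dickson_one_add_one {R : Type*} [CommRing R] (a : R) (j : ℕ) :
    dickson 1 a (j + 1) = 2 * dickson 2 a (j + 1) - X * dickson 2 a j ∧
    dickson 1 a (j + 2) = dickson 2 a (j + 2) - C a * dickson 2 a j := by
  induction j with
  | zero =>
    constructor
    · simp only [dickson_zero, dickson_one, zero_add]; push_cast; ring
    · simp only [dickson_two, dickson_zero, zero_add]; push_cast; ring
  | succ j ih =>
    have h1 : dickson 1 a (j + 1 + 1) =
        2 * dickson 2 a (j + 1 + 1) - X * dickson 2 a (j + 1) := by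
      have := ih.2
      rw [dickson_add_two 2] at this ⊢
      rw [this]; ring
    refine ⟨h1, ?_⟩
    rw [dickson_add_two 1, dickson_add_two 2 _ (j + 1), h1, ih.1]
    have := dickson_add_two 2 a j
    rw [this]; ring

section Darts

variable {n : ℕ} (X : SimpleGraph (Fin n))

/-- Permutation matrix of the dart reversal. -/
def reversal : Matrix X.Dart X.Dart ℝ := Matrix.of fun e f => if f = e.symm then 1 else 0

lemma reversal_transpose : (reversal X)ᵀ = reversal X := by
  ext e f
  simp only [reversal, Matrix.transpose_apply, Matrix.of_apply]
  congr 1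
  exact propext ⟨fun h => by rw [h, SimpleGraph.Dart.symm_symm],
    fun h => by rw [h, SimpleGraph.Dart.symm_symm]⟩

variable [DecidableRel X.Adj]

/-- Incidence matrix of darts with their initial vertices. -/
def startMatrix : Matrix X.Dart (Fin n) ℝ := Matrix.of fun e v => if e.fst = v then 1 else 0

/-- Incidence matrix of darts with their terminal vertices. -/
def endMatrix : Matrix X.Dart (Fin n) ℝ := Matrix.of fun e v => if e.snd = v then 1 else 0

lemma hashimoto_eq : hashimoto X = endMatrix X * (startMatrix X)ᵀ - reversal X := by
  ext e f
  simp only [hashimoto, endMatrix, startMatrix, reversal, Matrix.sub_apply, Matrix.mul_apply,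
    Matrix.of_apply, Matrix.transpose_apply, ite_mul, one_mul, zero_mul, Finset.sum_ite_eq,
    Finset.mem_univ, if_true]
  by_cases h : f = e.symm
  · subst h; simp
  · simp [h, eq_comm]

lemma reversal_mul {m : Type*} (M : Matrix X.Dart m ℝ) :
    reversal X * M = Matrix.of fun e j => M e.symm j := by
  ext e j
  simp [reversal, Matrix.mul_apply]

lemma reversal_mul_startMatrix : reversal X * startMatrix X = endMatrix X := by
  rw [reversal_mul]; rfl

lemma reversal_mul_endMatrix : reversal X * endMatrix X = startMatrix X := by
  rw [reversal_mul]; rfl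

lemma reversal_mul_reversal : reversal X * reversal X = 1 := by
  rw [reversal_mul]
  ext e f
  simp [reversal, Matrix.one_apply, eq_comm]

lemma startMatrix_transpose_mul_reversal : (startMatrix X)ᵀ * reversal X = (endMatrix X)ᵀ := by
  rw [← reversal_mul_startMatrix, Matrix.transpose_mul, reversal_transpose]

lemma startMatrix_transpose_mul_endMatrix :
    (startMatrix X)ᵀ * endMatrix X = X.adjMatrix ℝ := by
  ext u v
  simp only [startMatrix, endMatrix, Matrix.mul_apply, Matrix.transpose_apply, Matrix.of_apply,
    SimpleGraph.adjMatrix_apply, ← ite_and, mul_ite, mul_one, mul_zero]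
  split_ifs with h
  · rw [Finset.sum_eq_single (⟨(u, v), h⟩ : X.Dart)]
    · simp
    · rintro ⟨⟨a, b⟩, hab⟩ - hne
      rw [if_neg]
      rintro ⟨rfl, rfl⟩
      exact hne rfl
    · simp
  · refine Finset.sum_eq_zero fun e _ => if_neg ?_
    rintro ⟨rfl, rfl⟩
    exact h e.adj

variable {X} {q : ℕ}

lemma startMatrix_transpose_mul_startMatrix (hreg : X.IsRegularOfDegree (q + 1)) :
    (startMatrix X)ᵀ * startMatrix X = ((q : ℝ) + 1) • (1 : Matrix (Fin n) (Fin n) ℝ) := by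
  ext u v
  simp only [startMatrix, Matrix.mul_apply, Matrix.transpose_apply, Matrix.of_apply,
    ← ite_and, mul_ite, mul_one, mul_zero, Matrix.smul_apply, Matrix.one_apply, smul_eq_mul]
  split_ifs with h
  · subst h
    simp only [and_self, Finset.sum_boole]
    rw [SimpleGraph.dart_fst_fiber_card_eq_degree, hreg u]
    push_cast; rfl
  · refine Finset.sum_eq_zero fun e _ => if_neg ?_
    rintro ⟨rfl, rfl⟩
    exact h rfl

lemma endMatrix_transpose_mul_endMatrix (hreg : X.IsRegularOfDegree (q + 1)) :
    (endMatrix X)ᵀ * endMatrix X = ((q : ℝ) + 1) • (1 : Matrix (Fin n) (Fin n) ℝ) := by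
  rw [← startMatrix_transpose_mul_reversal, Matrix.mul_assoc, reversal_mul_endMatrix,
    startMatrix_transpose_mul_startMatrix hreg]

lemma endMatrix_transpose_mul_startMatrix :
    (endMatrix X)ᵀ * startMatrix X = X.adjMatrix ℝ := by
  rw [← startMatrix_transpose_mul_reversal, Matrix.mul_assoc, reversal_mul_startMatrix,
    startMatrix_transpose_mul_endMatrix]

lemma hashimoto_mul_endMatrix :
    hashimoto X * endMatrix X = endMatrix X * X.adjMatrix ℝ - startMatrix X := by
  rw [hashimoto_eq, Matrix.sub_mul, Matrix.mul_assoc, startMatrix_transpose_mul_endMatrix,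
    reversal_mul_endMatrix]

lemma hashimoto_mul_startMatrix (hreg : X.IsRegularOfDegree (q + 1)) :
    hashimoto X * startMatrix X = (q : ℝ) • endMatrix X := by
  rw [hashimoto_eq, Matrix.sub_mul, Matrix.mul_assoc, startMatrix_transpose_mul_startMatrix hreg,
    reversal_mul_startMatrix, Matrix.mul_smul, Matrix.mul_one, add_smul, one_smul,
    add_sub_cancel_right]

lemma hashimoto_mul_reversal :
    hashimoto X * reversal X = endMatrix X * (endMatrix X)ᵀ - 1 := by
  rw [hashimoto_eq, Matrix.sub_mul, Matrix.mul_assoc, startMatrix_transpose_mul_reversal,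
    reversal_mul_reversal]

lemma aeval_dickson_add_two (k : ℕ) (a : ℝ) (A : Matrix (Fin n) (Fin n) ℝ) (j : ℕ) :
    aeval A (dickson k a (j + 2)) =
      A * aeval A (dickson k a (j + 1)) - a • aeval A (dickson k a j) := by
  rw [dickson_add_two, map_sub, map_mul, map_mul, aeval_X, aeval_C, Algebra.smul_def]

lemma aeval_dickson_two_zero (a : ℝ) (A : Matrix (Fin n) (Fin n) ℝ) :
    aeval A (dickson 2 a 0) = 1 := by
  have : dickson 2 a 0 = 1 := by rw [dickson_zero]; norm_num
  rw [this, map_one]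

lemma hashimoto_pow_mul_endMatrix (hreg : X.IsRegularOfDegree (q + 1)) (j : ℕ) :
    hashimoto X ^ (j + 1) * endMatrix X =
      endMatrix X * aeval (X.adjMatrix ℝ) (dickson 2 (q : ℝ) (j + 1)) -
        startMatrix X * aeval (X.adjMatrix ℝ) (dickson 2 (q : ℝ) j) := by
  induction j with
  | zero =>
    rw [aeval_dickson_two_zero, zero_add, dickson_one, aeval_X, pow_one, hashimoto_mul_endMatrix,
      Matrix.mul_one]
  | succ j ih =>
    rw [pow_succ', Matrix.mul_assoc, ih, Matrix.mul_sub, ← Matrix.mul_assoc, ← Matrix.mul_assoc,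
      hashimoto_mul_endMatrix, hashimoto_mul_startMatrix hreg, aeval_dickson_add_two,
      Matrix.sub_mul, Matrix.mul_sub, Matrix.mul_assoc, Matrix.smul_mul, Matrix.mul_smul]
    abel

lemma Ngc_add_two (k : ℕ) :
    Ngc X (k + 2) = Ngc X k + ((startMatrix X)ᵀ * (hashimoto X ^ (k + 1) * endMatrix X)).trace -
      ((endMatrix X)ᵀ * (hashimoto X ^ k * endMatrix X)).trace := by
  have h : hashimoto X ^ (k + 2) =
      hashimoto X ^ (k + 1) * endMatrix X * (startMatrix X)ᵀ -
        hashimoto X ^ k * endMatrix X * (endMatrix X)ᵀ + hashimoto X ^ k := by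
    calc hashimoto X ^ (k + 2)
        = hashimoto X ^ (k + 1) * (endMatrix X * (startMatrix X)ᵀ - reversal X) := by
          rw [← hashimoto_eq, ← pow_succ]
      _ = hashimoto X ^ (k + 1) * endMatrix X * (startMatrix X)ᵀ -
            hashimoto X ^ k * (hashimoto X * reversal X) := by
          rw [Matrix.mul_sub, pow_succ, Matrix.mul_assoc _ _ (reversal X), ← Matrix.mul_assoc _ _
            (startMatrix X)ᵀ]
      _ = _ := by
          rw [hashimoto_mul_reversal, Matrix.mul_sub, Matrix.mul_one, ← Matrix.mul_assoc]
          abel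
  rw [Ngc, h, Matrix.trace_add, Matrix.trace_sub, Matrix.trace_mul_comm _ (startMatrix X)ᵀ,
    Matrix.trace_mul_comm _ (endMatrix X)ᵀ, Ngc]
  ring

lemma Ngc_add_two_sub (hreg : X.IsRegularOfDegree (q + 1)) (k : ℕ) :
    Ngc X (k + 2) - Ngc X k =
      (aeval (X.adjMatrix ℝ) (dickson 1 (q : ℝ) (k + 2))).trace -
        (aeval (X.adjMatrix ℝ) (dickson 1 (q : ℝ) k)).trace := by
  rw [Ngc_add_two, hashimoto_pow_mul_endMatrix hreg, Matrix.mul_sub, ← Matrix.mul_assoc,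
    ← Matrix.mul_assoc, startMatrix_transpose_mul_endMatrix,
    startMatrix_transpose_mul_startMatrix hreg, add_sub_assoc, add_sub_cancel_left,
    ← Matrix.trace_sub, ← Matrix.trace_sub]
  congr 1
  cases k with
  | zero =>
    have h : dickson 1 (q : ℝ) (0 + 2) = Polynomial.X ^ 2 - C (2 * (q : ℝ)) := by
      rw [zero_add, dickson_two, C_mul]
      push_cast
      rw [show (C 2 : ℝ[X]) = 2 from rfl]
      ring
    have h' : dickson 1 (q : ℝ) 0 = C 2 := by
      rw [dickson_zero, show (C 2 : ℝ[X]) = 2 from rfl]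
      push_cast; ring
    rw [pow_zero, Matrix.one_mul, endMatrix_transpose_mul_endMatrix hreg, h, h',
      aeval_dickson_two_zero, zero_add, dickson_one, map_sub, map_pow, aeval_C, aeval_C, aeval_X,
      Algebra.algebraMap_eq_smul_one, Algebra.algebraMap_eq_smul_one, Matrix.mul_one, sq]
    module
  | succ j =>
    rw [hashimoto_pow_mul_endMatrix hreg, Matrix.mul_sub, ← Matrix.mul_assoc,
      ← Matrix.mul_assoc, endMatrix_transpose_mul_endMatrix hreg,
      endMatrix_transpose_mul_startMatrix]
    rw [(dickson_one_add_one (q : ℝ) j).1, (dickson_one_add_one (q : ℝ) (j + 1)).2,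
      map_sub, map_sub, map_mul, map_mul, map_mul, aeval_dickson_add_two _ _ _ (j + 1), aeval_X,
      aeval_C, map_ofNat, Algebra.algebraMap_eq_smul_one, Matrix.smul_mul, Matrix.smul_mul,
      Matrix.one_mul, two_mul]
    module

/-- The trace formula for non-backtracking closed walks of even length. -/
lemma Ngc_two_mul (hreg : X.IsRegularOfDegree (q + 1)) (m : ℕ) :
    Ngc X (2 * m) = (aeval (X.adjMatrix ℝ) (dickson 1 (q : ℝ) (2 * m))).trace +
      n * ((q : ℝ) - 1) := by
  induction m with
  | zero =>
    have h' : dickson 1 (q : ℝ) 0 = C 2 := by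
      rw [dickson_zero, show (C 2 : ℝ[X]) = 2 from rfl]
      push_cast; ring
    have hcard : (Fintype.card X.Dart : ℝ) = n * ((q : ℝ) + 1) := by
      rw [SimpleGraph.dart_card_eq_sum_degrees, Finset.sum_congr rfl fun v _ => hreg v]
      simp
    rw [mul_zero, h', Ngc, pow_zero, Matrix.trace_one, hcard, aeval_C,
      Algebra.algebraMap_eq_smul_one, Matrix.trace_smul, Matrix.trace_one, Fintype.card_fin,
      smul_eq_mul]
    ring
  | succ m ih =>
    have := Ngc_add_two_sub hreg (2 * m)
    rw [mul_add, mul_one]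
    linarith

end Darts

lemma trace_aeval_eq_sum_eigenvalues {ι : Type*} [Fintype ι] [DecidableEq ι]
    {A : Matrix ι ι ℝ} (hA : A.IsHermitian) (p : ℝ[X]) :
    (aeval A p).trace = ∑ i, p.eval (hA.eigenvalues i) := by
  have hd : aeval (diagonal hA.eigenvalues) p = diagonal fun i => p.eval (hA.eigenvalues i) := by
    have h := Polynomial.aeval_algHom_apply (Matrix.diagonalAlgHom ℝ) hA.eigenvalues p
    simp only [Matrix.diagonalAlgHom_apply] at h
    rw [h]
    congr 1
    ext i
    simp
  have hs : A = Unitary.conjStarAlgAut ℝ _ hA.eigenvectorUnitary (diagonal hA.eigenvalues) :=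
    hA.spectral_theorem
  have h2 : aeval A p = Unitary.conjStarAlgAut ℝ _ hA.eigenvectorUnitary
      (aeval (diagonal hA.eigenvalues) p) := by
    conv_lhs => rw [hs]
    exact Polynomial.aeval_algHom_apply
      (Unitary.conjStarAlgAut ℝ _ hA.eigenvectorUnitary).toAlgEquiv.toAlgHom _ p
  rw [h2, hd, Unitary.conjStarAlgAut_apply, Matrix.trace_mul_comm, ← Matrix.mul_assoc,
    Unitary.coe_star_mul_self, Matrix.one_mul, Matrix.trace_diagonal]

lemma dickson_one_eval_add {R : Type*} [CommRing R] (x y : R) (k : ℕ) :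
    (dickson 1 (x * y) k).eval (x + y) = x ^ k + y ^ k := by
  induction k using Nat.twoStepInduction with
  | zero => rw [dickson_zero, Nat.cast_one, pow_zero, pow_zero]; norm_num
  | one => simp
  | more k h1 h2 =>
    rw [dickson_add_two, eval_sub, eval_mul, eval_mul, eval_X, eval_C, h1, h2]
    ring

lemma dickson_one_eval_cos (r θ : ℝ) (k : ℕ) :
    (dickson 1 (r ^ 2) k).eval (2 * r * Real.cos θ) = 2 * r ^ k * Real.cos (k * θ) := by
  induction k using Nat.twoStepInduction with
  | zero => rw [dickson_zero, Nat.cast_one, pow_zero, Nat.cast_zero, zero_mul, Real.cos_zero]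
            norm_num
  | one => simp
  | more k h1 h2 =>
    rw [dickson_add_two, eval_sub, eval_mul, eval_mul, eval_X, eval_C, h1, h2]
    have h3 : Real.cos ((k + 2 : ℕ) * θ) =
        2 * Real.cos θ * Real.cos ((k + 1 : ℕ) * θ) - Real.cos (k * θ) := by
      have e1 : ((k + 2 : ℕ) : ℝ) * θ = ((k + 1 : ℕ) : ℝ) * θ + θ := by push_cast; ring
      have e2 : (k : ℝ) * θ = ((k + 1 : ℕ) : ℝ) * θ - θ := by push_cast; ring
      rw [e1, e2, Real.cos_add, Real.cos_sub]
      ring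
    rw [h3]
    ring

lemma exists_add_inv_eq {x : ℝ} (hx : 2 ≤ x) : ∃ y : ℝ, 1 ≤ y ∧ y + y⁻¹ = x := by
  have hs : Real.sqrt (x ^ 2 - 4) ^ 2 = x ^ 2 - 4 := Real.sq_sqrt (by nlinarith)
  have hn := Real.sqrt_nonneg (x ^ 2 - 4)
  refine ⟨(x + Real.sqrt (x ^ 2 - 4)) / 2, by linarith, ?_⟩
  have hinv : ((x + Real.sqrt (x ^ 2 - 4)) / 2)⁻¹ = (x - Real.sqrt (x ^ 2 - 4)) / 2 := by
    apply inv_eq_of_mul_eq_one_right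
    nlinarith
  rw [hinv]
  ring

/-- Outside the Ramanujan interval, an even-index Dickson polynomial is a sum of reciprocal
powers. -/
lemma exists_dickson_one_eval {r l : ℝ} (hr : 0 < r) (hl : 2 * r ≤ |l|) {k : ℕ} (hk : Even k) :
    ∃ y : ℝ, 1 ≤ y ∧ |l| = r * (y + y⁻¹) ∧
      (dickson 1 (r ^ 2) k).eval l = r ^ k * (y ^ k + y⁻¹ ^ k) := by
  obtain ⟨y, hy, hyx⟩ := exists_add_inv_eq (x := |l| / r) ((le_div_iff₀ hr).2 hl)
  have hl' : |l| = r * (y + y⁻¹) := by rw [hyx]; field_simp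
  have hy0 : y ≠ 0 := by positivity
  refine ⟨y, hy, hl', ?_⟩
  rcases abs_choice l with h | h
  · have h1 := dickson_one_eval_add (r * y) (r * y⁻¹) k
    rw [show r * y * (r * y⁻¹) = r ^ 2 by field_simp, ← mul_add, ← hl', h, mul_pow, mul_pow] at h1
    rw [h1, mul_add]
  · have h1 := dickson_one_eval_add (-(r * y)) (-(r * y⁻¹)) k
    rw [show -(r * y) * -(r * y⁻¹) = r ^ 2 by field_simp, ← neg_add, ← mul_add, ← hl', h, neg_neg,
      hk.neg_pow, hk.neg_pow, mul_pow, mul_pow] at h1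
    rw [h1, mul_add]

lemma neg_two_mul_pow_le_dickson_one_eval {r : ℝ} (hr : 0 < r) (l : ℝ) {k : ℕ} (hk : Even k) :
    -(2 * r ^ k) ≤ (dickson 1 (r ^ 2) k).eval l := by
  have hrk : 0 < r ^ k := pow_pos hr k
  rcases le_total (2 * r) |l| with h | h
  · obtain ⟨y, hy, -, he⟩ := exists_dickson_one_eval hr h hk
    rw [he]
    have : 0 ≤ r ^ k * (y ^ k + y⁻¹ ^ k) := by positivity
    linarith
  · have h2 := abs_le.1 h
    have hc : l = 2 * r * Real.cos (Real.arccos (l / (2 * r))) := by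
      rw [Real.cos_arccos]
      · field_simp
      · rw [le_div_iff₀ (by positivity)]; linarith
      · rw [div_le_iff₀ (by positivity)]; linarith
    rw [hc, dickson_one_eval_cos]
    nlinarith [Real.neg_one_le_cos (k * Real.arccos (l / (2 * r)))]

lemma one_add_pow_le {y : ℝ} (hy : 1 ≤ y) (k : ℕ) :
    1 + (y + y⁻¹ - 1) ^ k ≤ y ^ k + y⁻¹ ^ k := by
  have hy0 : 0 < y := by linarith
  have hi : 0 < y⁻¹ := inv_pos.2 hy0
  have hi1 : y⁻¹ ≤ 1 := inv_le_one_of_one_le₀ hy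
  induction k with
  | zero => norm_num
  | succ k ih =>
    have h1 : 1 ≤ y ^ k := one_le_pow₀ hy
    have h2 : y⁻¹ ^ k ≤ 1 := pow_le_one₀ hi.le hi1
    have h3 : (y + y⁻¹ - 1) ^ k ≤ y ^ k := pow_le_pow_left₀ (by linarith) (by linarith) k
    have h4 : 0 ≤ (y + y⁻¹ - 1) := by linarith
    rw [pow_succ, pow_succ, pow_succ]
    nlinarith [mul_le_mul_of_nonneg_left ih h4]

section Eigenvalues

variable {n q : ℕ} {X : SimpleGraph (Fin n)} [DecidableRel X.Adj]

lemma eigenvalue_le_of_regular (hreg : X.IsRegularOfDegree (q + 1))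
    (hA : (X.adjMatrix ℝ).IsHermitian) (i : Fin n) : hA.eigenvalues i ≤ q + 1 := by
  have hev : Module.End.HasEigenvalue (Matrix.toLin' (X.adjMatrix ℝ)) (hA.eigenvalues i) := by
    rw [Module.End.hasEigenvalue_iff_mem_spectrum, Matrix.spectrum_toLin']
    exact hA.eigenvalues_mem_spectrum_real i
  obtain ⟨j, hj⟩ := eigenvalue_mem_ball hev
  rw [Metric.mem_closedBall, SimpleGraph.adjMatrix_apply, if_neg (X.loopless.irrefl j),
    Real.dist_eq, sub_zero] at hj
  refine (le_abs_self _).trans (hj.trans ?_)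
  calc ∑ m ∈ Finset.univ.erase j, ‖X.adjMatrix ℝ j m‖
      ≤ ∑ m, ‖X.adjMatrix ℝ j m‖ :=
        Finset.sum_le_sum_of_subset_of_nonneg (Finset.erase_subset _ _)
          fun _ _ _ => norm_nonneg _
    _ = ∑ m, X.adjMatrix ℝ j m := by
        refine Finset.sum_congr rfl fun m _ => Real.norm_of_nonneg ?_
        rw [SimpleGraph.adjMatrix_apply]; split_ifs <;> norm_num
    _ = q + 1 := by
        have h := SimpleGraph.adjMatrix_mulVec_const_apply_of_regular (α := ℝ) (a := 1) hreg (v := j)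
        simpa [Matrix.mulVec, dotProduct] using h

lemma exists_eigenvalue_eq_of_regular (hn : 0 < n) (hreg : X.IsRegularOfDegree (q + 1))
    (hA : (X.adjMatrix ℝ).IsHermitian) : ∃ i, hA.eigenvalues i = q + 1 := by
  have hmem : (q + 1 : ℝ) ∈ spectrum ℝ (X.adjMatrix ℝ) := by
    rw [← Matrix.spectrum_toLin', ← Module.End.hasEigenvalue_iff_mem_spectrum]
    refine Module.End.hasEigenvalue_of_hasEigenvector (x := Function.const _ 1) ⟨?_, ?_⟩
    · rw [Module.End.mem_eigenspace_iff]
      ext v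
      rw [Matrix.toLin'_apply, SimpleGraph.adjMatrix_mulVec_const_apply_of_regular hreg]
      simp
    · exact fun h => one_ne_zero (congrFun h (⟨0, hn⟩ : Fin n))
  rw [hA.spectrum_real_eq_range_eigenvalues] at hmem
  exact hmem

end Eigenvalues

end NonBacktracking

open NonBacktracking in
theorem spectral_bound_of_even_Hk_nonneg {q n : ℕ} (hq : 1 ≤ q) (hn : 2 ≤ n)
    (X : SimpleGraph (Fin n)) [DecidableRel X.Adj]
    (hconn : X.Connected) (hreg : X.IsRegularOfDegree (q + 1))
    (hA : (X.adjMatrix ℝ).IsHermitian)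
    (lam : Fin n → ℝ)
    (hperm : ∃ σ : Equiv.Perm (Fin n), ∀ i, lam i = hA.eigenvalues (σ i))
    (hanti : ∀ i j : Fin n, i ≤ j → lam j ≤ lam i)
    (k : ℕ) (hk : 2 ≤ k) (hke : Even k) (hH : 0 ≤ Hseq q X k) :
    mu q lam ≤ 1 + (4 * (n : ℝ) - 7) ^ ((k : ℝ))⁻¹ := by
  have hn0 : 0 < n := by omega
  have hnR : (2 : ℝ) ≤ n := by exact_mod_cast hn
  obtain ⟨σ, hσ⟩ := hperm
  set r := Real.sqrt q with hrdef
  have hqR : (0 : ℝ) < q := by exact_mod_cast hq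
  have hr : 0 < r := Real.sqrt_pos.2 hqR
  have hr2 : r ^ 2 = q := Real.sq_sqrt hqR.le
  have hrk : 0 < r ^ k := pow_pos hr k
  set p := Polynomial.dickson 1 ((q : ℝ)) k with hp
  have h0 : lam ⟨0, hn0⟩ = q + 1 := by
    refine le_antisymm ?_ ?_
    · rw [hσ]; exact eigenvalue_le_of_regular hreg hA _
    · obtain ⟨i, hi⟩ := exists_eigenvalue_eq_of_regular hn0 hreg hA
      rw [← hi, ← σ.apply_symm_apply i, ← hσ]
      exact hanti _ _ (Fin.mk_le_of_le_val (Nat.zero_le _))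
  have hp0 : p.eval (lam ⟨0, hn0⟩) = r ^ k * r ^ k + 1 := by
    have := dickson_one_eval_add (q : ℝ) 1 k
    rw [mul_one, one_pow] at this
    rw [h0, hp, this, ← hr2, ← pow_mul, ← pow_add, two_mul]
  have hN : Ngc X k = ∑ i, p.eval (lam i) + n * ((q : ℝ) - 1) := by
    obtain ⟨m, rfl⟩ := even_iff_two_dvd.1 hke
    rw [Ngc_two_mul hreg, trace_aeval_eq_sum_eigenvalues hA]
    simp only [hσ]
    rw [Equiv.sum_comp σ fun i => p.eval (hA.eigenvalues i)]
  have hsum : ∑ i ∈ Finset.univ.erase ⟨0, hn0⟩, p.eval (lam i) ≤ 2 * ((n : ℝ) - 1) * r ^ k := by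
    rw [Hseq, if_neg (Nat.not_odd_iff_even.2 hke), ← hrdef, hN, add_sub_cancel_right,
      ← Finset.add_sum_erase _ _ (Finset.mem_univ (⟨0, hn0⟩ : Fin n)), hp0] at hH
    have h1 := mul_nonneg hrk.le hH
    have h2 : r ^ k * (r ^ k)⁻¹ = 1 := mul_inv_cancel₀ hrk.ne'
    have h3 : ∀ S : ℝ, r ^ k * (2 * ((n : ℝ) - 1) + r ^ k + (r ^ k)⁻¹ -
        (r ^ k)⁻¹ * (r ^ k * r ^ k + 1 + S)) = 2 * ((n : ℝ) - 1) * r ^ k - S := by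
      intro S
      field_simp
      ring
    rw [h3] at h1
    linarith
  have hz : (1 : ℝ) ≤ (4 * (n : ℝ) - 7) ^ ((k : ℝ))⁻¹ :=
    Real.one_le_rpow (by linarith) (by positivity)
  have key : ∀ i : Fin n, (i : ℕ) ≠ 0 →
      |lam i| ≤ r * (1 + (4 * (n : ℝ) - 7) ^ ((k : ℝ))⁻¹) := by
    intro i hi
    rcases le_total |lam i| (2 * r) with h | h
    · nlinarith
    obtain ⟨y, hy, hly, hpy⟩ := exists_dickson_one_eval hr h hke
    rw [hr2, ← hp] at hpy
    have hi0 : i ∈ Finset.univ.erase (⟨0, hn0⟩ : Fin n) := by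
      simp [Fin.ext_iff, hi]
    have hrest : -(2 * r ^ k) * ((n : ℝ) - 2) ≤
        ∑ j ∈ (Finset.univ.erase (⟨0, hn0⟩ : Fin n)).erase i, p.eval (lam j) := by
      have hc := Finset.card_nsmul_le_sum ((Finset.univ.erase (⟨0, hn0⟩ : Fin n)).erase i)
        (fun j => p.eval (lam j)) (-(2 * r ^ k)) fun j _ => by
          have := neg_two_mul_pow_le_dickson_one_eval hr (lam j) hke
          rwa [hr2] at this
      rw [Finset.card_erase_of_mem hi0, Finset.card_erase_of_mem (Finset.mem_univ _),
        Finset.card_univ, Fintype.card_fin, nsmul_eq_mul, Nat.sub_sub, Nat.cast_sub hn] at hc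
      push_cast at hc
      linarith
    rw [← Finset.add_sum_erase _ _ hi0, hpy] at hsum
    have hyk : y ^ k + y⁻¹ ^ k ≤ 4 * n - 6 := by
      refine le_of_mul_le_mul_left ?_ hrk
      linarith
    have hpow : (y + y⁻¹ - 1) ^ k ≤ 4 * n - 7 := by linarith [one_add_pow_le hy k]
    have hbase : 0 ≤ y + y⁻¹ - 1 := by
      have : 0 ≤ y⁻¹ := by positivity
      linarith
    have hroot : y + y⁻¹ - 1 ≤ (4 * (n : ℝ) - 7) ^ ((k : ℝ))⁻¹ := by
      rw [← Real.pow_rpow_inv_natCast hbase (by omega : k ≠ 0)]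
      exact Real.rpow_le_rpow (by positivity) hpow (by positivity)
    rw [hly]
    exact mul_le_mul_of_nonneg_left (by linarith) hr.le
  rw [mu, ← hrdef, inv_mul_le_iff₀ hr]
  refine csSup_le ⟨_, ⟨1, by omega⟩, one_ne_zero, rfl⟩ ?_
  rintro x ⟨i, hi, rfl⟩
  exact key i hi
end
end

section
/- Let q ≥ 1 and n ≥ 2 be integers and let X be a connected (q+1)-regular simple undirected graph on n vertices. Then H_k ≥ 0 for all integers k ≥ 1 if and only if μ(X) ≤ 2. -/
open Matrix Filter

noncomputable section

namespace SimpleGraph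

variable {V : Type*} [Fintype V] [DecidableEq V] (G : SimpleGraph V) [DecidableRel G.Adj]

/-- The incidence matrix of vertices with the darts leaving them. -/
def dartFstMatrix : Matrix V G.Dart ℝ :=
  Matrix.of fun v e => if e.fst = v then 1 else 0

/-- The incidence matrix of vertices with the darts entering them. -/
def dartSndMatrix : Matrix V G.Dart ℝ :=
  Matrix.of fun v e => if e.snd = v then 1 else 0

/-- The permutation matrix of dart reversal. -/
def dartSymmMatrix : Matrix G.Dart G.Dart ℝ :=
  Matrix.of fun e f => if f = e.symm then 1 else 0

theorem dartFstMatrix_mul_dartSymmMatrix :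
    G.dartFstMatrix * G.dartSymmMatrix = G.dartSndMatrix := by
  ext v e
  have h (x : G.Dart) : e = x.symm ↔ x = e.symm := by
    constructor <;> rintro rfl <;> simp
  simp [Matrix.mul_apply, dartFstMatrix, dartSymmMatrix, dartSndMatrix, h]

theorem dartSymmMatrix_mul_self : G.dartSymmMatrix * G.dartSymmMatrix = 1 := by
  ext e f
  simp only [Matrix.mul_apply, dartSymmMatrix, Matrix.of_apply, ite_mul, one_mul, zero_mul,
    Finset.sum_ite_eq', Finset.mem_univ, if_true, Dart.symm_symm, Matrix.one_apply, eq_comm]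

theorem dartSndMatrix_mul_dartSymmMatrix :
    G.dartSndMatrix * G.dartSymmMatrix = G.dartFstMatrix := by
  rw [← dartFstMatrix_mul_dartSymmMatrix, Matrix.mul_assoc, dartSymmMatrix_mul_self,
    Matrix.mul_one]

theorem dartSymmMatrix_mul_transpose_dartSndMatrix :
    G.dartSymmMatrix * G.dartSndMatrixᵀ = G.dartFstMatrixᵀ := by
  ext e v
  simp only [Matrix.mul_apply, dartFstMatrix, dartSymmMatrix, dartSndMatrix, Matrix.of_apply,
    Matrix.transpose_apply, ite_mul, one_mul, zero_mul, Finset.sum_ite_eq', Finset.mem_univ,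
    if_true]
  rfl

theorem dartFstMatrix_mul_transpose_dartSndMatrix :
    G.dartFstMatrix * G.dartSndMatrixᵀ = G.adjMatrix ℝ := by
  ext u v
  simp only [Matrix.mul_apply, dartFstMatrix, dartSndMatrix, Matrix.transpose_apply,
    Matrix.of_apply, adjMatrix_apply, mul_ite, mul_one, mul_zero, ← ite_and]
  split_ifs with h
  · rw [Finset.sum_eq_single ⟨(u, v), h⟩]
    · simp
    · rintro ⟨⟨a, b⟩, hab⟩ - hne
      simp only [ne_eq, Dart.mk.injEq, Prod.mk.injEq] at hne
      exact if_neg fun h' => hne ⟨h'.2, h'.1⟩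
    · simp
  · refine Finset.sum_eq_zero fun e _ => if_neg ?_
    rintro ⟨rfl, rfl⟩
    exact h e.adj

theorem dartSndMatrix_mul_transpose_dartFstMatrix :
    G.dartSndMatrix * G.dartFstMatrixᵀ = G.adjMatrix ℝ := by
  rw [← Matrix.transpose_transpose (G.dartSndMatrix * _), Matrix.transpose_mul,
    Matrix.transpose_transpose, dartFstMatrix_mul_transpose_dartSndMatrix, transpose_adjMatrix]

variable {G}

theorem IsRegularOfDegree.dartFstMatrix_mul_transpose {d : ℕ} (h : G.IsRegularOfDegree d) :
    G.dartFstMatrix * G.dartFstMatrixᵀ = (d : ℝ) • (1 : Matrix V V ℝ) := by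
  ext u v
  simp only [Matrix.mul_apply, dartFstMatrix, Matrix.transpose_apply, Matrix.of_apply, mul_ite,
    mul_one, mul_zero, ← ite_and, Matrix.smul_apply, Matrix.one_apply, smul_eq_mul]
  split_ifs with huv
  · subst huv
    rw [← h u, ← dart_fst_fiber_card_eq_degree]
    simp
  · refine Finset.sum_eq_zero fun e _ => if_neg ?_
    rintro ⟨rfl, rfl⟩
    exact huv rfl

theorem IsRegularOfDegree.dartSndMatrix_mul_transpose {d : ℕ} (h : G.IsRegularOfDegree d) :
    G.dartSndMatrix * G.dartSndMatrixᵀ = (d : ℝ) • (1 : Matrix V V ℝ) := by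
  nth_rw 1 [← dartFstMatrix_mul_dartSymmMatrix]
  rw [Matrix.mul_assoc, dartSymmMatrix_mul_transpose_dartSndMatrix, h.dartFstMatrix_mul_transpose]

theorem IsRegularOfDegree.natCast_mem_spectrum_adjMatrix [Nonempty V] {d : ℕ}
    (h : G.IsRegularOfDegree d) : (d : ℝ) ∈ spectrum ℝ (G.adjMatrix ℝ) := by
  rw [← Matrix.spectrum_toLin']
  refine (Module.End.hasEigenvalue_of_hasEigenvector (x := Function.const V 1) ?_).mem_spectrum
  refine Module.End.hasEigenvector_iff.mpr ⟨Module.End.mem_eigenspace_iff.mpr ?_, ?_⟩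
  · ext v
    rw [Matrix.toLin'_apply, adjMatrix_mulVec_const_apply_of_regular h]
    simp
  · exact fun h0 => one_ne_zero (congrFun h0 (Classical.arbitrary V))

theorem IsRegularOfDegree.le_of_mem_spectrum_adjMatrix {d : ℕ} (h : G.IsRegularOfDegree d)
    {x : ℝ} (hx : x ∈ spectrum ℝ (G.adjMatrix ℝ)) : x ≤ d := by
  rw [← Matrix.spectrum_toLin', ← Module.End.hasEigenvalue_iff_mem_spectrum] at hx
  obtain ⟨v, hv⟩ := eigenvalue_mem_ball hx
  rw [Metric.mem_closedBall, Real.dist_eq] at hv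
  have hsum : ∑ w, ‖G.adjMatrix ℝ v w‖ = d := by
    simp [adjMatrix_apply, apply_ite, ← neighborFinset_eq_filter, h.degree_eq]
  have := Finset.sum_le_sum_of_subset_of_nonneg (Finset.erase_subset v Finset.univ)
    fun w _ _ => norm_nonneg (G.adjMatrix ℝ v w)
  have h0 : G.adjMatrix ℝ v v = 0 := by simp
  rw [h0, sub_zero] at hv
  linarith [le_abs_self x]

end SimpleGraph

theorem Matrix.aeval_diagonal {R m : Type*} [CommSemiring R] [Fintype m] [DecidableEq m]
    (d : m → R) (p : Polynomial R) :
    p.aeval (diagonal d) = diagonal fun i => p.eval (d i) := by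
  rw [← diagonalAlgHom_apply R, Polynomial.aeval_algHom_apply, diagonalAlgHom_apply]
  congr 1
  ext i
  simp [Polynomial.aeval_fn_apply]

theorem Matrix.IsHermitian.trace_aeval {m : Type*} [Fintype m] [DecidableEq m]
    {A : Matrix m m ℝ} (hA : A.IsHermitian) (p : Polynomial ℝ) :
    (p.aeval A).trace = ∑ i, p.eval (hA.eigenvalues i) := by
  have h : p.aeval A = Unitary.conjStarAlgAut ℝ _ hA.eigenvectorUnitary
      (diagonal fun i => p.eval (hA.eigenvalues i)) := by
    conv_lhs => rw [hA.spectral_theorem]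
    rw [← StarAlgEquiv.coe_toAlgEquiv, ← AlgEquiv.coe_toAlgHom, Polynomial.aeval_algHom_apply,
      Matrix.aeval_diagonal]
    rfl
  rw [h, Unitary.conjStarAlgAut_apply, Matrix.trace_mul_cycle]
  simp

namespace Polynomial

theorem dickson_one_eval_mul {R : Type*} [CommRing R] (s y : R) :
    ∀ k : ℕ, (dickson 1 (s ^ 2) k).eval (s * y) = s ^ k * (Chebyshev.C R k).eval y
  | 0 => by simp [dickson_zero]; norm_num
  | 1 => by simp
  | k + 2 => by
    have h := Chebyshev.C_add_two R k
    push_cast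
    rw [h, dickson_add_two]
    have h1 := dickson_one_eval_mul s y (k + 1)
    push_cast at h1
    simp only [eval_sub, eval_mul, eval_X, eval_C, dickson_one_eval_mul s y k, h1]
    ring

namespace Chebyshev

theorem eval_C_real_le_two {y : ℝ} (hy : |y| ≤ 2) (k : ℤ) : (C ℝ k).eval y ≤ 2 := by
  obtain ⟨h1, h2⟩ := abs_le.mp hy
  have hc : y = 2 * Real.cos (Real.arccos (y / 2)) := by
    rw [Real.cos_arccos (by linarith) (by linarith)]; ring
  rw [hc, C_two_mul_real_cos]
  linarith [Real.cos_le_one (k * Real.arccos (y / 2))]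

theorem eval_C_two_mul {R : Type*} [CommRing R] (k : ℤ) (y : R) :
    (C R (2 * k)).eval y = (C R k).eval y ^ 2 - 2 := by
  simp [C_mul, C_two]

theorem le_eval_C_two_pow {y : ℝ} (hy : 2 < |y|) (j : ℕ) :
    2 + 4 ^ j * (y ^ 2 - 4) ≤ (C ℝ ((2 ^ (j + 1) : ℕ) : ℤ)).eval y := by
  have hpos : 0 < y ^ 2 - 4 := by
    rw [← sq_abs]; nlinarith
  induction j with
  | zero => simp [C_two]; linarith
  | succ j ih =>
    rw [pow_succ' 2 (j + 1), Nat.cast_mul, Nat.cast_ofNat, eval_C_two_mul]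
    have : 0 < 4 ^ j * (y ^ 2 - 4) := by positivity
    rw [pow_succ]
    nlinarith

end Chebyshev

end Polynomial

section

open SimpleGraph Polynomial

variable {n : ℕ} {X : SimpleGraph (Fin n)} [DecidableRel X.Adj]

theorem hashimoto_eq (X : SimpleGraph (Fin n)) [DecidableRel X.Adj] :
    hashimoto X = X.dartSndMatrixᵀ * X.dartFstMatrix - X.dartSymmMatrix := by
  ext e f
  by_cases h : f = e.symm
  · simp [hashimoto, Matrix.mul_apply, dartFstMatrix, dartSndMatrix, dartSymmMatrix, h]
  · simp [hashimoto, Matrix.mul_apply, dartFstMatrix, dartSndMatrix, dartSymmMatrix, h, eq_comm]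

theorem dartFstMatrix_mul_hashimoto :
    X.dartFstMatrix * hashimoto X = X.adjMatrix ℝ * X.dartFstMatrix - X.dartSndMatrix := by
  rw [hashimoto_eq, Matrix.mul_sub, ← Matrix.mul_assoc, dartFstMatrix_mul_transpose_dartSndMatrix,
    dartFstMatrix_mul_dartSymmMatrix]

theorem dartSymmMatrix_mul_hashimoto :
    X.dartSymmMatrix * hashimoto X = X.dartFstMatrixᵀ * X.dartFstMatrix - 1 := by
  rw [hashimoto_eq, Matrix.mul_sub, ← Matrix.mul_assoc, dartSymmMatrix_mul_transpose_dartSndMatrix,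
    dartSymmMatrix_mul_self]

variable {q : ℕ}

theorem dartSndMatrix_mul_hashimoto (hreg : X.IsRegularOfDegree (q + 1)) :
    X.dartSndMatrix * hashimoto X = (q : ℝ) • X.dartFstMatrix := by
  rw [hashimoto_eq, Matrix.mul_sub, ← Matrix.mul_assoc, hreg.dartSndMatrix_mul_transpose,
    dartSndMatrix_mul_dartSymmMatrix, Matrix.smul_mul, Matrix.one_mul]
  push_cast
  module

theorem dartFstMatrix_mul_hashimoto_pow_add_two (hreg : X.IsRegularOfDegree (q + 1)) (k : ℕ) :
    X.dartFstMatrix * hashimoto X ^ (k + 2) =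
      X.adjMatrix ℝ * (X.dartFstMatrix * hashimoto X ^ (k + 1))
        - (q : ℝ) • (X.dartFstMatrix * hashimoto X ^ k) := by
  rw [pow_succ' _ (k + 1), ← Matrix.mul_assoc, dartFstMatrix_mul_hashimoto, Matrix.sub_mul,
    Matrix.mul_assoc, pow_succ' _ k, ← Matrix.mul_assoc X.dartSndMatrix,
    dartSndMatrix_mul_hashimoto hreg, Matrix.smul_mul]

theorem Ngc_add_two (X : SimpleGraph (Fin n)) [DecidableRel X.Adj] (k : ℕ) :
    Ngc X (k + 2) = Ngc X k
      + (X.dartFstMatrix * hashimoto X ^ (k + 1) * X.dartSndMatrixᵀ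
        - X.dartFstMatrix * hashimoto X ^ k * X.dartFstMatrixᵀ).trace := by
  have h1 : hashimoto X ^ (k + 2) =
      X.dartSndMatrixᵀ * (X.dartFstMatrix * hashimoto X ^ (k + 1))
        - (X.dartFstMatrixᵀ * (X.dartFstMatrix * hashimoto X ^ k) - hashimoto X ^ k) := by
    rw [pow_succ' _ (k + 1)]
    nth_rw 1 [hashimoto_eq]
    rw [Matrix.sub_mul, Matrix.mul_assoc, pow_succ' _ k, ← Matrix.mul_assoc X.dartSymmMatrix,
      dartSymmMatrix_mul_hashimoto, Matrix.sub_mul, Matrix.one_mul, Matrix.mul_assoc]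
  rw [Ngc, h1, Matrix.trace_sub, Matrix.trace_sub, Matrix.trace_sub, Matrix.trace_mul_comm,
    Matrix.trace_mul_comm X.dartFstMatrixᵀ, Ngc]
  ring

theorem aeval_dickson_sub (hreg : X.IsRegularOfDegree (q + 1)) : ∀ k : ℕ,
    X.dartFstMatrix * hashimoto X ^ (k + 1) * X.dartSndMatrixᵀ
        - X.dartFstMatrix * hashimoto X ^ k * X.dartFstMatrixᵀ =
      (dickson 1 (q : ℝ) (k + 2)).aeval (X.adjMatrix ℝ)
        - (dickson 1 (q : ℝ) k).aeval (X.adjMatrix ℝ)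
  | 0 => by
    rw [zero_add, pow_one, pow_zero, dartFstMatrix_mul_hashimoto, Matrix.mul_one, Matrix.sub_mul,
      Matrix.mul_assoc, dartFstMatrix_mul_transpose_dartSndMatrix, hreg.dartSndMatrix_mul_transpose,
      hreg.dartFstMatrix_mul_transpose, dickson_two, dickson_zero]
    simp only [aeval_sub, aeval_mul, map_ofNat, aeval_X, map_pow, map_natCast,
      Algebra.smul_def, map_add, map_one, Nat.cast_add, Nat.cast_one]
    rw [show (3 : Matrix (Fin n) (Fin n) ℝ) = 1 + 1 + 1 by norm_num]
    noncomm_ring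
  | 1 => by
    have h := dartFstMatrix_mul_hashimoto_pow_add_two hreg 0
    rw [zero_add, pow_one, dartFstMatrix_mul_hashimoto, pow_zero, Matrix.mul_one] at h
    rw [h, pow_one, dartFstMatrix_mul_hashimoto, dickson_add_two, dickson_two, dickson_one]
    simp only [Matrix.sub_mul, Matrix.mul_sub, Matrix.mul_assoc, Matrix.smul_mul,
      dartFstMatrix_mul_transpose_dartSndMatrix, hreg.dartSndMatrix_mul_transpose,
      hreg.dartFstMatrix_mul_transpose, dartSndMatrix_mul_transpose_dartFstMatrix]
    simp only [aeval_sub, aeval_mul, map_ofNat, aeval_X, map_pow, map_natCast,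
      Algebra.smul_def, map_add, map_one, Nat.cast_add, Nat.cast_one]
    have hcomm := Nat.cast_comm q (X.adjMatrix ℝ)
    noncomm_ring [hcomm]
  | k + 2 => by
    have h0 := aeval_dickson_sub hreg k
    have h1 := aeval_dickson_sub hreg (k + 1)
    have hd (j : ℕ) : (dickson 1 (q : ℝ) (j + 2)).aeval (X.adjMatrix ℝ) =
        X.adjMatrix ℝ * (dickson 1 (q : ℝ) (j + 1)).aeval (X.adjMatrix ℝ)
          - (q : ℝ) • (dickson 1 (q : ℝ) j).aeval (X.adjMatrix ℝ) := by
      simp [dickson_add_two, Algebra.smul_def]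
    have hW (j : ℕ) (M : Matrix X.Dart (Fin n) ℝ) : X.dartFstMatrix * hashimoto X ^ (j + 2) * M =
        X.adjMatrix ℝ * (X.dartFstMatrix * hashimoto X ^ (j + 1) * M)
          - (q : ℝ) • (X.dartFstMatrix * hashimoto X ^ j * M) := by
      rw [dartFstMatrix_mul_hashimoto_pow_add_two hreg, Matrix.sub_mul, Matrix.mul_assoc,
        Matrix.smul_mul]
    calc _ = X.adjMatrix ℝ * (X.dartFstMatrix * hashimoto X ^ (k + 1 + 1) * X.dartSndMatrixᵀ
            - X.dartFstMatrix * hashimoto X ^ (k + 1) * X.dartFstMatrixᵀ)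
          - (q : ℝ) • (X.dartFstMatrix * hashimoto X ^ (k + 1) * X.dartSndMatrixᵀ
            - X.dartFstMatrix * hashimoto X ^ k * X.dartFstMatrixᵀ) := by
          rw [hW k, hW (k + 1), mul_sub]
          module
      _ = _ := by
          rw [h0, h1, hd (k + 2), hd k, mul_sub]
          module

theorem Ngc_eq_sum (hreg : X.IsRegularOfDegree (q + 1)) (hA : (X.adjMatrix ℝ).IsHermitian) :
    ∀ k : ℕ, Ngc X k = ∑ i, (dickson 1 (q : ℝ) k).eval (hA.eigenvalues i)
      + if Odd k then 0 else (n : ℝ) * ((q : ℝ) - 1)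
  | 0 => by
    simp [Ngc, dart_card_eq_sum_degrees, hreg.degree_eq, dickson_zero]
    ring
  | 1 => by
    simp only [dickson_one, eval_X, odd_one, if_true, add_zero]
    have : (X.adjMatrix ℝ).trace = ∑ i, hA.eigenvalues i := by
      simpa using hA.trace_eq_sum_eigenvalues
    rw [← this, SimpleGraph.trace_adjMatrix]
    simp [Ngc, Matrix.trace, hashimoto, (Dart.symm_ne _).symm]
  | k + 2 => by
    rw [Ngc_add_two, aeval_dickson_sub hreg, Matrix.trace_sub, hA.trace_aeval, hA.trace_aeval,
      Ngc_eq_sum hreg hA k]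
    have : Odd (k + 2) ↔ Odd k := by grind
    simp only [this]
    ring

theorem Hseq_eq_sum (hq : 1 ≤ q) (hreg : X.IsRegularOfDegree (q + 1))
    (hA : (X.adjMatrix ℝ).IsHermitian) {i₀ : Fin n} (hi₀ : hA.eigenvalues i₀ = q + 1) (k : ℕ) :
    Hseq q X k = ∑ i ∈ Finset.univ.erase i₀,
      (2 - (Chebyshev.C ℝ k).eval ((Real.sqrt q)⁻¹ * hA.eigenvalues i)) := by
  have hs : 0 < Real.sqrt q := Real.sqrt_pos.mpr (by exact_mod_cast hq)
  have hs2 : Real.sqrt q ^ 2 = q := Real.sq_sqrt (Nat.cast_nonneg q)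
  set s := Real.sqrt q
  have hscale (x : ℝ) :
      (Chebyshev.C ℝ k).eval (s⁻¹ * x) = (s ^ k)⁻¹ * (dickson 1 (q : ℝ) k).eval x := by
    have := dickson_one_eval_mul s (s⁻¹ * x) k
    rw [hs2, mul_inv_cancel_left₀ hs.ne'] at this
    rw [this, inv_mul_cancel_left₀ (by positivity)]
  have htop : (Chebyshev.C ℝ k).eval (s⁻¹ * hA.eigenvalues i₀) = s ^ k + (s ^ k)⁻¹ := by
    have : s⁻¹ * hA.eigenvalues i₀ = s + s⁻¹ := by
      rw [hi₀, ← hs2]; field_simp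
    rw [this, ← dickson_one_one_eq_chebyshev_C,
      dickson_one_one_eval_add_inv _ _ (mul_inv_cancel₀ hs.ne'), inv_pow]
  have hsum : Hseq q X k = 2 * ((n : ℝ) - 1) + s ^ k + (s ^ k)⁻¹
      - ∑ i, (Chebyshev.C ℝ k).eval (s⁻¹ * hA.eigenvalues i) := by
    simp_rw [hscale, ← Finset.mul_sum]
    rw [Hseq, Ngc_eq_sum hreg hA]
    split_ifs <;> ring
  rw [hsum, ← Finset.add_sum_erase _ _ (Finset.mem_univ i₀), htop, Finset.sum_sub_distrib,
    Finset.sum_const, Finset.card_erase_of_mem (Finset.mem_univ i₀), Finset.card_univ,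
    Fintype.card_fin, nsmul_eq_mul, Nat.cast_pred (Fin.pos i₀)]
  ring

theorem mu_le_iff (hn : 2 ≤ n) (lam : Fin n → ℝ) (c : ℝ) :
    mu q lam ≤ c ↔ ∀ i : Fin n, (i : ℕ) ≠ 0 → |(Real.sqrt q)⁻¹ * lam i| ≤ c := by
  have hne : {x : ℝ | ∃ i : Fin n, (i : ℕ) ≠ 0 ∧ x = |lam i|}.Nonempty :=
    ⟨_, ⟨1, hn⟩, one_ne_zero, rfl⟩
  have hfin : {x : ℝ | ∃ i : Fin n, (i : ℕ) ≠ 0 ∧ x = |lam i|}.Finite :=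
    (Set.finite_range fun i => |lam i|).subset (by rintro _ ⟨i, -, rfl⟩; exact ⟨i, rfl⟩)
  have hs : 0 ≤ (Real.sqrt q)⁻¹ := by positivity
  simp_rw [abs_mul, abs_of_nonneg hs]
  constructor
  · exact fun h i hi =>
      (mul_le_mul_of_nonneg_left (le_csSup hfin.bddAbove ⟨i, hi, rfl⟩) hs).trans h
  · intro h
    obtain ⟨i, hi, hx⟩ := hne.csSup_mem hfin
    rw [mu, hx]
    exact h i hi

theorem forall_Hseq_nonneg_iff (hq : 1 ≤ q) (hreg : X.IsRegularOfDegree (q + 1))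
    (hA : (X.adjMatrix ℝ).IsHermitian) {i₀ : Fin n} (hi₀ : hA.eigenvalues i₀ = q + 1) :
    (∀ k : ℕ, 1 ≤ k → 0 ≤ Hseq q X k) ↔
      ∀ i ≠ i₀, |(Real.sqrt q)⁻¹ * hA.eigenvalues i| ≤ 2 := by
  simp_rw [Hseq_eq_sum hq hreg hA hi₀]
  refine ⟨fun h i hi => ?_, fun h k _ => Finset.sum_nonneg fun i hi => sub_nonneg.mpr
    (Chebyshev.eval_C_real_le_two (h i (Finset.ne_of_mem_erase hi)) k)⟩
  by_contra! hlt
  set y : Fin n → ℝ := fun i => (Real.sqrt q)⁻¹ * hA.eigenvalues i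
  have hpos : 0 < y i ^ 2 - 4 := by
    rw [← sq_abs]; nlinarith
  obtain ⟨j, hj⟩ := ((tendsto_pow_atTop_atTop_of_one_lt (by norm_num : (1 : ℝ) < 4)).atTop_mul_const
    hpos |>.eventually_gt_atTop (4 * (n : ℝ))).exists
  have hk := h (2 ^ (j + 1)) Nat.one_le_two_pow
  rw [← Finset.add_sum_erase _ _ (Finset.mem_erase.mpr ⟨hi, Finset.mem_univ i⟩)] at hk
  have hi' := Chebyshev.le_eval_C_two_pow hlt j
  have hrest : ∑ l ∈ (Finset.univ.erase i₀).erase i,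
      (2 - (Chebyshev.C ℝ ((2 ^ (j + 1) : ℕ) : ℤ)).eval (y l)) ≤ 4 * n := by
    refine (Finset.sum_le_card_nsmul _ _ 4 fun l _ => ?_).trans ?_
    · rw [pow_succ', Nat.cast_mul, Nat.cast_ofNat, Chebyshev.eval_C_two_mul]
      nlinarith [sq_nonneg ((Chebyshev.C ℝ ((2 ^ j : ℕ) : ℤ)).eval (y l))]
    · rw [nsmul_eq_mul, mul_comm]
      have : ((Finset.univ.erase i₀).erase i).card ≤ n := by
        simpa using Finset.card_le_univ ((Finset.univ.erase i₀).erase i)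
      have : (((Finset.univ.erase i₀).erase i).card : ℝ) ≤ n := by exact_mod_cast this
      linarith
  linarith

end

theorem Hk_nonneg_iff_mu_le_two {q n : ℕ} (hq : 1 ≤ q) (hn : 2 ≤ n)
    (X : SimpleGraph (Fin n)) [DecidableRel X.Adj]
    (hconn : X.Connected) (hreg : X.IsRegularOfDegree (q + 1))
    (hA : (X.adjMatrix ℝ).IsHermitian)
    (lam : Fin n → ℝ)
    (hperm : ∃ σ : Equiv.Perm (Fin n), ∀ i, lam i = hA.eigenvalues (σ i))
    (hanti : ∀ i j : Fin n, i ≤ j → lam j ≤ lam i) :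
    (∀ k : ℕ, 1 ≤ k → 0 ≤ Hseq q X k) ↔ mu q lam ≤ 2 := by
  obtain ⟨σ, hσ⟩ := hperm
  let z : Fin n := ⟨0, by omega⟩
  have : Nonempty (Fin n) := ⟨z⟩
  have htop : hA.eigenvalues (σ z) = q + 1 := by
    refine le_antisymm ?_ ?_
    · exact_mod_cast hreg.le_of_mem_spectrum_adjMatrix (hA.eigenvalues_mem_spectrum_real (σ z))
    · have h := hreg.natCast_mem_spectrum_adjMatrix
      rw [hA.spectrum_real_eq_range_eigenvalues] at h
      obtain ⟨i, hi⟩ := h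
      have hle := hanti z (σ.symm i) (Nat.zero_le _)
      rw [hσ, hσ, σ.apply_symm_apply, hi] at hle
      exact_mod_cast hle
  rw [forall_Hseq_nonneg_iff hq hreg hA htop, mu_le_iff hn, ← σ.forall_congr_right]
  simp [hσ, z, Fin.ext_iff]
end
end

section
/- Let q ≥ 1 and n ≥ 2 be integers and let X be a connected (q+1)-regular simple undirected graph on n vertices. If μ(X) > 2, then the sequence √(H_{2k+2}/H_{2k}) + √(H_{2k}/H_{2k+2}) converges to μ(X) as k → ∞. -/
open Matrix Filter

noncomputable section

open Polynomial in
/-- The trace of a polynomial in a real symmetric matrix is the sum of its values at the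
eigenvalues. -/
theorem trace_aeval_eq_sum_eigenvalues {V : Type*} [Fintype V] [DecidableEq V]
    {A : Matrix V V ℝ} (hA : A.IsHermitian) (p : ℝ[X]) :
    (aeval A p).trace = ∑ i, p.eval (hA.eigenvalues i) := by
  have hconj : aeval A p = Unitary.conjStarAlgAut ℝ _ hA.eigenvectorUnitary
      (aeval (diagonal (RCLike.ofReal ∘ hA.eigenvalues : V → ℝ)) p) := by
    conv_lhs => rw [hA.spectral_theorem]
    exact aeval_algHom_apply
      (Unitary.conjStarAlgAut ℝ _ hA.eigenvectorUnitary).toStarAlgHom.toAlgHom _ p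
  have hdiag : aeval (diagonal (RCLike.ofReal ∘ hA.eigenvalues : V → ℝ)) p
      = diagonal (fun i => p.eval (hA.eigenvalues i)) := by
    have h := aeval_algHom_apply (diagonalAlgHom (n := V) (α := ℝ) ℝ)
      (RCLike.ofReal ∘ hA.eigenvalues : V → ℝ) p
    rw [diagonalAlgHom_apply, diagonalAlgHom_apply] at h
    rw [h]
    congr 1
    ext i
    rw [aeval_pi_apply₂]
    simp [aeval_def, eval₂_eq_eval_map]
  rw [hconj, hdiag, Unitary.conjStarAlgAut_apply, trace_mul_cycle]
  simp [trace_diagonal]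

section NonBacktracking

variable {V D : Type*} [Fintype V] [DecidableEq V] [Fintype D] [DecidableEq D]
  {S T : Matrix V D ℝ} {P Q : Matrix D V ℝ} {J : Matrix D D ℝ} {A : Matrix V V ℝ} {q : ℝ}

open Polynomial in
theorem exists_nonbacktracking_pow_mul (hSP : S * P = A) (hSQ : S * Q = (q + 1) • 1)
    (hJP : J * P = Q) (hJQ : J * Q = P) (k : ℕ) :
    ∃ F G : Matrix V V ℝ, (P * S - J) ^ k * P = P * F + Q * G ∧
      (2 : ℝ) • F + A * G = aeval A (dickson 1 q k) ∧
      A * F + (2 * q) • G = aeval A (dickson 1 q (k + 1)) := by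
  induction k with
  | zero =>
    refine ⟨1, 0, by simp, ?_, by simp⟩
    have h : (3 - 1 : ℝ[X]) = C 2 := by
      rw [map_ofNat]
      norm_num
    rw [mul_zero, add_zero, dickson_zero, Nat.cast_one, h, aeval_C,
      Algebra.algebraMap_eq_smul_one]
  | succ k ih =>
    obtain ⟨F, G, hW, hD, hD'⟩ := ih
    refine ⟨A * F + q • G, -F, ?_, ?_, ?_⟩
    · rw [pow_succ', Matrix.mul_assoc, hW]
      simp only [Matrix.mul_add, Matrix.sub_mul, ← Matrix.mul_assoc, hJP, hJQ]
      simp only [Matrix.mul_assoc P S, hSP, hSQ, Matrix.mul_assoc P A]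
      simp only [Matrix.mul_smul, Matrix.smul_mul, Matrix.mul_one, Matrix.mul_neg]
      module
    · rw [← hD', Matrix.mul_neg]
      module
    · rw [dickson_add_two, map_sub, map_mul, map_mul, aeval_X, aeval_C, ← hD', ← hD,
        Algebra.algebraMap_eq_smul_one]
      simp only [Matrix.mul_add, Matrix.mul_smul, Matrix.smul_mul, Matrix.one_mul]
      module

open Polynomial in
theorem trace_nonbacktracking_pow_add_two (hSP : S * P = A) (hSQ : S * Q = (q + 1) • 1)
    (hTP : T * P = (q + 1) • 1) (hTQ : T * Q = A) (hJP : J * P = Q) (hJQ : J * Q = P)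
    (hSJ : S * J = T) (hJJ : J * J = 1) (k : ℕ) :
    ((P * S - J) ^ (k + 2)).trace - ((P * S - J) ^ k).trace =
      (aeval A (dickson 1 q (k + 2))).trace - (aeval A (dickson 1 q k)).trace := by
  obtain ⟨F, G, hW, hD, hD'⟩ := exists_nonbacktracking_pow_mul hSP hSQ hJP hJQ k
  set W := P * S - J with hWdef
  have hstep : W ^ (k + 1) * P = P * (A * F + q • G) - Q * F := by
    rw [pow_succ', Matrix.mul_assoc, hW, hWdef]
    simp only [Matrix.mul_add, Matrix.sub_mul, ← Matrix.mul_assoc, hJP, hJQ]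
    simp only [Matrix.mul_assoc P S, hSP, hSQ, Matrix.mul_assoc P A]
    simp only [Matrix.mul_smul, Matrix.smul_mul, Matrix.mul_one]
    module
  have hJ : W * J = P * T - 1 := by
    rw [hWdef, Matrix.sub_mul, Matrix.mul_assoc, hSJ, hJJ]
  have h1 : W ^ (k + 2) = W ^ (k + 1) * P * S - W ^ k * P * T + W ^ k := by
    have : W ^ (k + 2) = W ^ (k + 1) * (P * S) - W ^ k * (W * J) := by
      rw [← Matrix.mul_assoc (W ^ k), ← pow_succ, ← Matrix.mul_sub, ← hWdef, ← pow_succ]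
    rw [this, hJ, Matrix.mul_sub, Matrix.mul_one, Matrix.mul_assoc, Matrix.mul_assoc]
    abel
  rw [h1, trace_add, trace_sub, trace_mul_comm (W ^ (k + 1) * P) S,
    trace_mul_comm (W ^ k * P) T, hstep, hW, Matrix.mul_sub, Matrix.mul_add T,
    ← Matrix.mul_assoc S P, ← Matrix.mul_assoc S Q, ← Matrix.mul_assoc T P,
    ← Matrix.mul_assoc T Q, hSP, hSQ, hTP, hTQ, dickson_add_two, map_sub, map_mul, map_mul,
    aeval_X, aeval_C, ← hD', ← hD, Algebra.algebraMap_eq_smul_one]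
  simp only [Matrix.mul_add, Matrix.mul_smul, Matrix.smul_mul, Matrix.one_mul,
    trace_add, trace_sub, trace_smul, smul_eq_mul]
  ring

end NonBacktracking

section Incidence

variable {n : ℕ} (X : SimpleGraph (Fin n)) [DecidableRel X.Adj]

/-- The incidence matrix between vertices and the darts starting there. -/
def startIncidence : Matrix (Fin n) X.Dart ℝ :=
  Matrix.of fun v e => if e.fst = v then 1 else 0

/-- The incidence matrix between vertices and the darts ending there. -/
def endIncidence : Matrix (Fin n) X.Dart ℝ :=
  Matrix.of fun v e => if e.snd = v then 1 else 0

/-- The permutation matrix reversing darts. -/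
def dartReversal : Matrix X.Dart X.Dart ℝ :=
  Matrix.of fun e f => if f = e.symm then 1 else 0

theorem hashimoto_eq_s2 :
    hashimoto X = (endIncidence X)ᵀ * startIncidence X - dartReversal X := by
  ext e f
  simp only [hashimoto, endIncidence, startIncidence, dartReversal, mul_apply, Matrix.sub_apply,
    transpose_apply, of_apply, ite_mul, one_mul, zero_mul, Finset.sum_ite_eq, Finset.mem_univ,
    if_true]
  by_cases hf : f = e.symm
  · simp [hf]
  · simp [hf, eq_comm]

theorem dartReversal_mul_apply {V : Type*} (M : Matrix X.Dart V ℝ) (e : X.Dart) (v : V) :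
    (dartReversal X * M) e v = M e.symm v := by
  simp [dartReversal, mul_apply]

theorem mul_dartReversal_apply {V : Type*} (M : Matrix V X.Dart ℝ) (v : V) (e : X.Dart) :
    (M * dartReversal X) v e = M v e.symm := by
  have h (x : X.Dart) : e = x.symm ↔ x = e.symm := by
    constructor <;> rintro rfl <;> simp
  simp [dartReversal, mul_apply, h]

theorem dartReversal_mul_self : dartReversal X * dartReversal X = 1 := by
  ext e f
  rw [dartReversal_mul_apply]
  simp [dartReversal, one_apply, eq_comm]

theorem startIncidence_mul_dartReversal :
    startIncidence X * dartReversal X = endIncidence X := by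
  ext v e
  rw [mul_dartReversal_apply]
  simp [startIncidence, endIncidence]

theorem dartReversal_mul_transpose_endIncidence :
    dartReversal X * (endIncidence X)ᵀ = (startIncidence X)ᵀ := by
  ext e v
  rw [dartReversal_mul_apply]
  simp [startIncidence, endIncidence]

theorem dartReversal_mul_transpose_startIncidence :
    dartReversal X * (startIncidence X)ᵀ = (endIncidence X)ᵀ := by
  rw [← dartReversal_mul_transpose_endIncidence, ← Matrix.mul_assoc, dartReversal_mul_self,
    Matrix.one_mul]

theorem startIncidence_mul_transpose_endIncidence :
    startIncidence X * (endIncidence X)ᵀ = X.adjMatrix ℝ := by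
  ext v w
  simp only [startIncidence, endIncidence, mul_apply, transpose_apply, of_apply, ite_mul, one_mul,
    zero_mul, ← ite_and, SimpleGraph.adjMatrix_apply]
  by_cases h : X.Adj v w
  · rw [Finset.sum_eq_single (⟨(v, w), h⟩ : X.Dart)]
    · simp [h]
    · rintro e - hne
      refine if_neg fun he => hne ?_
      ext
      · exact congrArg Fin.val he.1
      · exact congrArg Fin.val he.2
    · simp
  · rw [if_neg h]
    refine Finset.sum_eq_zero fun e _ => if_neg ?_
    rintro ⟨rfl, rfl⟩
    exact h e.adj

theorem endIncidence_mul_transpose_startIncidence :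
    endIncidence X * (startIncidence X)ᵀ = X.adjMatrix ℝ := by
  rw [← transpose_transpose (endIncidence X), ← transpose_mul,
    startIncidence_mul_transpose_endIncidence, SimpleGraph.transpose_adjMatrix]

variable {X}

theorem startIncidence_mul_transpose_self {d : ℕ} (hreg : X.IsRegularOfDegree d) :
    startIncidence X * (startIncidence X)ᵀ = (d : ℝ) • 1 := by
  ext v w
  simp only [startIncidence, mul_apply, transpose_apply, of_apply, ite_mul, one_mul,
    zero_mul, ← ite_and, Matrix.smul_apply, one_apply]
  by_cases h : v = w
  · subst h
    simp only [and_self, Finset.sum_boole, if_true, smul_eq_mul, mul_one]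
    rw [X.dart_fst_fiber_card_eq_degree, hreg v]
  · rw [if_neg h, smul_zero]
    refine Finset.sum_eq_zero fun e _ => if_neg ?_
    rintro ⟨rfl, rfl⟩
    exact h rfl

theorem endIncidence_mul_transpose_self {d : ℕ} (hreg : X.IsRegularOfDegree d) :
    endIncidence X * (endIncidence X)ᵀ = (d : ℝ) • 1 := by
  rw [← startIncidence_mul_dartReversal X, Matrix.mul_assoc, startIncidence_mul_dartReversal,
    dartReversal_mul_transpose_endIncidence, startIncidence_mul_transpose_self hreg]

open Polynomial in
/-- The number of geodesic cycles of even length in terms of the adjacency matrix. -/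
theorem Ngc_two_mul {q : ℕ} (hreg : X.IsRegularOfDegree (q + 1)) (k : ℕ) :
    Ngc X (2 * k) = n * ((q : ℝ) - 1) +
      (aeval (X.adjMatrix ℝ) (dickson 1 (q : ℝ) (2 * k))).trace := by
  induction k with
  | zero =>
    have hcard : (Fintype.card X.Dart : ℝ) = n * (q + 1) := by
      rw [X.dart_card_eq_sum_degrees]
      simp [hreg.degree_eq]
    have h3 : (3 - 1 : ℝ[X]) = C 2 := by
      rw [map_ofNat]
      norm_num
    simp only [Ngc, mul_zero, pow_zero, trace_one, hcard, dickson_zero, Nat.cast_one, h3, aeval_C,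
      Algebra.algebraMap_eq_smul_one, trace_smul, Fintype.card_fin, smul_eq_mul]
    ring
  | succ k ih =>
    have hreg' := startIncidence_mul_transpose_self hreg
    have hreg'' := endIncidence_mul_transpose_self hreg
    rw [Nat.cast_add_one] at hreg' hreg''
    have h := trace_nonbacktracking_pow_add_two (startIncidence_mul_transpose_endIncidence X)
      hreg' hreg'' (endIncidence_mul_transpose_startIncidence X)
      (dartReversal_mul_transpose_endIncidence X) (dartReversal_mul_transpose_startIncidence X)
      (startIncidence_mul_dartReversal X) (dartReversal_mul_self X) (2 * k)
    rw [← hashimoto_eq_s2] at h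
    rw [mul_add, mul_one]
    simp only [Ngc] at ih ⊢
    linarith

theorem adjMatrix_eigenvalues_le {d : ℕ} (hreg : X.IsRegularOfDegree d)
    (hA : (X.adjMatrix ℝ).IsHermitian) (i : Fin n) : hA.eigenvalues i ≤ d := by
  have hspec := hA.eigenvalues_mem_spectrum_real i
  rw [← Matrix.spectrum_toLin', ← Module.End.hasEigenvalue_iff_mem_spectrum] at hspec
  obtain ⟨v, hv⟩ := eigenvalue_mem_ball hspec
  have hsum : ∑ j ∈ Finset.univ.erase v, ‖X.adjMatrix ℝ v j‖ ≤ d := by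
    calc ∑ j ∈ Finset.univ.erase v, ‖X.adjMatrix ℝ v j‖
        ≤ ∑ j, ‖X.adjMatrix ℝ v j‖ :=
          Finset.sum_le_sum_of_subset_of_nonneg (Finset.erase_subset _ _) fun _ _ _ => norm_nonneg _
      _ = ∑ j, X.adjMatrix ℝ v j := by
          refine Finset.sum_congr rfl fun j _ => ?_
          by_cases h : X.Adj v j <;> simp [h]
      _ = d := by
          have := SimpleGraph.adjMatrix_mulVec_const_apply_of_regular (α := ℝ) (a := 1) hreg (v := v)
          simpa only [mulVec, dotProduct, Function.const_apply, mul_one] using this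
  rw [Metric.mem_closedBall, Real.dist_eq] at hv
  have := le_abs_self (hA.eigenvalues i - X.adjMatrix ℝ v v)
  simp only [SimpleGraph.adjMatrix_apply, SimpleGraph.irrefl, if_false] at this hv hsum
  linarith

theorem exists_adjMatrix_eigenvalues_eq {d : ℕ} (hreg : X.IsRegularOfDegree d) (hn : 0 < n)
    (hA : (X.adjMatrix ℝ).IsHermitian) : ∃ i, hA.eigenvalues i = d := by
  have hspec : (d : ℝ) ∈ spectrum ℝ (X.adjMatrix ℝ) := by
    rw [← Matrix.spectrum_toLin', ← Module.End.hasEigenvalue_iff_mem_spectrum]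
    refine Module.End.hasEigenvalue_of_hasEigenvector (x := Function.const _ 1) ⟨?_, ?_⟩
    · rw [Module.End.mem_eigenspace_iff]
      ext v
      rw [Matrix.toLin'_apply, SimpleGraph.adjMatrix_mulVec_const_apply_of_regular hreg]
      simp
    · exact fun h => one_ne_zero (congrFun h ⟨0, hn⟩)
  rwa [hA.spectrum_real_eq_range_eigenvalues] at hspec

end Incidence

section Dickson

open Polynomial

theorem eval_dickson_one_sq (s x : ℝ) (k : ℕ) :
    (dickson 1 (s ^ 2) k).eval (s * x) = s ^ k * (dickson 1 1 k).eval x := by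
  induction k using Nat.twoStepInduction with
  | zero => simp
  | one => simp
  | more k h0 h1 =>
    simp only [dickson_add_two, eval_sub, eval_mul, eval_X, eval_C, h0, h1]
    ring

theorem eval_dickson_one_one_two_mul (x : ℝ) (k : ℕ) :
    (dickson 1 (1 : ℝ) (2 * k)).eval x = (dickson 1 1 k).eval (x ^ 2 - 2) := by
  rw [mul_comm, dickson_one_one_mul, eval_comp, dickson_two]
  norm_num

theorem abs_eval_dickson_one_one_le {y : ℝ} (hy : |y| ≤ 2) (k : ℕ) :
    |(dickson 1 (1 : ℝ) k).eval y| ≤ 2 := by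
  have hy' : |⅟2 * y| ≤ 1 := by
    rw [abs_mul, invOf_eq_inv, abs_of_pos (by norm_num : (0 : ℝ) < 2⁻¹)]
    linarith
  have h := Chebyshev.abs_eval_T_real_le_one k hy'
  rw [dickson_one_one_eq_chebyshev_T, eval_mul, eval_comp, eval_mul, eval_C, eval_X, abs_mul]
  norm_num at h ⊢
  exact h

theorem exists_add_inv_eq {y : ℝ} (hy : 2 < y) : ∃ r : ℝ, 1 < r ∧ r + r⁻¹ = y := by
  have hs := Real.sq_sqrt (show 0 ≤ y ^ 2 - 4 by nlinarith)
  have hnn := Real.sqrt_nonneg (y ^ 2 - 4)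
  refine ⟨(y + √(y ^ 2 - 4)) / 2, by linarith, ?_⟩
  field_simp
  nlinarith

theorem tendsto_eval_dickson_div_pow {r y : ℝ} (hr : 1 < r) (hy : -2 ≤ y) (hyr : y < r + r⁻¹) :
    Tendsto (fun k : ℕ => (dickson 1 (1 : ℝ) k).eval y / r ^ k) atTop (nhds 0) := by
  have hr0 : 0 < r := by linarith
  rcases le_or_gt y 2 with hy2 | hy2
  · have hlim : Tendsto (fun k : ℕ => 2 * (r⁻¹) ^ k) atTop (nhds 0) := by
      simpa using (tendsto_pow_atTop_nhds_zero_of_lt_one (inv_nonneg.2 hr0.le)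
        (inv_lt_one_of_one_lt₀ hr)).const_mul 2
    refine squeeze_zero_norm (fun k => ?_) hlim
    rw [norm_div, norm_pow, Real.norm_eq_abs, Real.norm_of_nonneg hr0.le, inv_pow, div_eq_mul_inv]
    gcongr
    exact abs_eval_dickson_one_one_le (abs_le.2 ⟨hy, hy2⟩) k
  · obtain ⟨t, ht, rfl⟩ := exists_add_inv_eq hy2
    have ht0 : 0 < t := by linarith
    have htr : t < r := by
      by_contra! h
      have hle : r + r⁻¹ ≤ t + t⁻¹ := by
        rw [← sub_nonneg]
        have : t + t⁻¹ - (r + r⁻¹) = (t - r) * (t * r - 1) / (t * r) := by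
          field_simp
          ring
        rw [this]
        have : 1 ≤ t * r := by nlinarith
        exact div_nonneg (mul_nonneg (by linarith) (by linarith)) (by positivity)
      linarith
    have h1 := tendsto_pow_atTop_nhds_zero_of_lt_one (div_nonneg ht0.le hr0.le)
      ((div_lt_one hr0).2 htr)
    have h2 := tendsto_pow_atTop_nhds_zero_of_lt_one (div_nonneg (inv_nonneg.2 ht0.le) hr0.le)
      ((div_lt_one hr0).2 ((inv_lt_one_of_one_lt₀ ht).trans hr))
    have h := h1.add h2
    rw [add_zero] at h
    refine h.congr fun k => ?_
    rw [dickson_one_one_eval_add_inv _ _ (mul_inv_cancel₀ ht0.ne'), div_pow, div_pow, add_div]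

theorem tendsto_eval_dickson_div_pow_self {r : ℝ} (hr : 1 < r) :
    Tendsto (fun k : ℕ => (dickson 1 (1 : ℝ) k).eval (r + r⁻¹) / r ^ k) atTop (nhds 1) := by
  have hr0 : 0 < r := by linarith
  have h := (tendsto_pow_atTop_nhds_zero_of_lt_one (div_nonneg (inv_nonneg.2 hr0.le) hr0.le)
    ((div_lt_one hr0).2 ((inv_lt_one_of_one_lt₀ hr).trans hr))).const_add 1
  rw [add_zero] at h
  refine h.congr fun k => ?_
  rw [dickson_one_one_eval_add_inv _ _ (mul_inv_cancel₀ hr0.ne'), add_div,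
    div_self (pow_pos hr0 k).ne', div_pow]

end Dickson

open Polynomial in
theorem Hseq_two_mul {q n : ℕ} (hq : 1 ≤ q) {X : SimpleGraph (Fin n)} [DecidableRel X.Adj]
    (hreg : X.IsRegularOfDegree (q + 1)) (hA : (X.adjMatrix ℝ).IsHermitian)
    {lam : Fin n → ℝ} (hperm : ∃ σ : Equiv.Perm (Fin n), ∀ i, lam i = hA.eigenvalues (σ i))
    {i₀ : Fin n} (hi₀ : lam i₀ = q + 1) (k : ℕ) :
    Hseq q X (2 * k) = ∑ i ∈ Finset.univ.erase i₀,
      (2 - (dickson 1 (1 : ℝ) k).eval (((√(q : ℝ))⁻¹ * lam i) ^ 2 - 2)) := by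
  obtain ⟨σ, hσ⟩ := hperm
  have hq0 : (0 : ℝ) < q := by exact_mod_cast hq
  have hs : 0 < √(q : ℝ) := Real.sqrt_pos.2 hq0
  have hs2 : √(q : ℝ) ^ 2 = q := Real.sq_sqrt hq0.le
  have hterm (i : Fin n) : (dickson 1 (q : ℝ) (2 * k)).eval (lam i) = √(q : ℝ) ^ (2 * k) *
      (dickson 1 (1 : ℝ) k).eval (((√(q : ℝ))⁻¹ * lam i) ^ 2 - 2) := by
    have h := eval_dickson_one_sq √(q : ℝ) ((√(q : ℝ))⁻¹ * lam i) (2 * k)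
    rwa [hs2, mul_inv_cancel_left₀ hs.ne', eval_dickson_one_one_two_mul] at h
  have htrace : (aeval (X.adjMatrix ℝ) (dickson 1 (q : ℝ) (2 * k))).trace =
      √(q : ℝ) ^ (2 * k) *
        ∑ i, (dickson 1 (1 : ℝ) k).eval (((√(q : ℝ))⁻¹ * lam i) ^ 2 - 2) := by
    rw [trace_aeval_eq_sum_eigenvalues hA, Finset.mul_sum, ← Equiv.sum_comp σ]
    simp only [← hσ, hterm]
  have htop : (dickson 1 (1 : ℝ) k).eval (((√(q : ℝ))⁻¹ * lam i₀) ^ 2 - 2) =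
      √(q : ℝ) ^ (2 * k) + (√(q : ℝ) ^ (2 * k))⁻¹ := by
    rw [← eval_dickson_one_one_two_mul, hi₀]
    have : (√(q : ℝ))⁻¹ * (q + 1) = √(q : ℝ) + (√(q : ℝ))⁻¹ := by
      nth_rw 2 [← hs2]
      field_simp
    rw [this, dickson_one_one_eval_add_inv _ _ (mul_inv_cancel₀ hs.ne'), inv_pow]
  have hsplit := Finset.add_sum_erase Finset.univ
    (fun i => (dickson 1 (1 : ℝ) k).eval (((√(q : ℝ))⁻¹ * lam i) ^ 2 - 2)) (Finset.mem_univ i₀)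
  have hcard : ((Finset.univ.erase i₀).card : ℝ) = n - 1 := by
    rw [Finset.card_erase_of_mem (Finset.mem_univ _), Finset.card_univ, Fintype.card_fin,
      Nat.cast_pred (Fin.pos i₀)]
  rw [Hseq, if_neg (by simp), Ngc_two_mul hreg, htrace, add_sub_cancel_left,
    inv_mul_cancel_left₀ (pow_pos hs _).ne', ← hsplit, htop, Finset.sum_sub_distrib,
    Finset.sum_const, nsmul_eq_mul, hcard]
  ring

theorem tendsto_succ_div_of_tendsto_div_pow {h : ℕ → ℝ} {r c : ℝ} (hr : r ≠ 0) (hc : c ≠ 0)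
    (hlim : Tendsto (fun k => h k / r ^ k) atTop (nhds c)) :
    Tendsto (fun k => h (k + 1) / h k) atTop (nhds r) := by
  have h1 := ((hlim.comp (tendsto_add_atTop_nat 1)).div hlim hc).mul_const r
  rw [div_self hc, one_mul] at h1
  refine h1.congr fun k => ?_
  have hk := pow_ne_zero k hr
  simp only [Function.comp_apply, Pi.div_apply, pow_succ]
  rcases eq_or_ne (h k) 0 with h0 | h0
  · simp [h0]
  · field_simp

theorem mu_eq_limit_of_mu_gt_two {q n : ℕ} (hq : 1 ≤ q) (hn : 2 ≤ n)
    (X : SimpleGraph (Fin n)) [DecidableRel X.Adj]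
    (hconn : X.Connected) (hreg : X.IsRegularOfDegree (q + 1))
    (hA : (X.adjMatrix ℝ).IsHermitian)
    (lam : Fin n → ℝ)
    (hperm : ∃ σ : Equiv.Perm (Fin n), ∀ i, lam i = hA.eigenvalues (σ i))
    (hanti : ∀ i j : Fin n, i ≤ j → lam j ≤ lam i)
    (hmu : 2 < mu q lam) :
    Tendsto
      (fun k : ℕ =>
        Real.sqrt (Hseq q X (2 * k + 2) / Hseq q X (2 * k)) +
          Real.sqrt (Hseq q X (2 * k) / Hseq q X (2 * k + 2)))
      atTop (nhds (mu q lam)) := by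
  obtain ⟨i₀, hi₀⟩ : ∃ i : Fin n, (i : ℕ) = 0 := ⟨⟨0, by omega⟩, rfl⟩
  have hq0 : (0 : ℝ) < q := by exact_mod_cast hq
  have hs : 0 < √(q : ℝ) := Real.sqrt_pos.2 hq0
  have htop : lam i₀ = q + 1 := by
    obtain ⟨σ, hσ⟩ := hperm
    obtain ⟨j, hj⟩ := exists_adjMatrix_eigenvalues_eq hreg (by omega) hA
    have hle := adjMatrix_eigenvalues_le hreg hA (σ i₀)
    have hge := hanti i₀ (σ.symm j) (Fin.le_def.2 (by omega))
    rw [hσ, Equiv.apply_symm_apply, hj] at hge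
    rw [← hσ] at hle
    push_cast at hle hge
    exact le_antisymm hle hge
  set E : Set ℝ := {x : ℝ | ∃ i : Fin n, (i : ℕ) ≠ 0 ∧ x = |lam i|}
  have hfin : E.Finite := (Set.finite_range fun i => |lam i|).subset (by
    rintro x ⟨i, -, rfl⟩
    exact ⟨i, rfl⟩)
  have hne : E.Nonempty := ⟨_, ⟨1, by omega⟩, one_ne_zero, rfl⟩
  obtain ⟨i₁, hi₁, hmax⟩ := hne.csSup_mem hfin
  have hmu_eq : mu q lam = (√(q : ℝ))⁻¹ * |lam i₁| := by rw [← hmax, mu]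
  have hle (i : Fin n) (hi : i ≠ i₀) : (√(q : ℝ))⁻¹ * |lam i| ≤ mu q lam := by
    rw [hmu_eq, ← hmax]
    gcongr
    exact le_csSup hfin.bddAbove ⟨i, fun h => hi (Fin.ext (h.trans hi₀.symm)), rfl⟩
  set m := mu q lam
  obtain ⟨r, hr, hrm⟩ := exists_add_inv_eq (show 2 < m ^ 2 - 2 by nlinarith)
  have hr0 : 0 < r := by linarith
  set y : Fin n → ℝ := fun i => ((√(q : ℝ))⁻¹ * lam i) ^ 2 - 2 with hy
  have hyabs (i : Fin n) : y i = ((√(q : ℝ))⁻¹ * |lam i|) ^ 2 - 2 := by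
    simp only [hy, mul_pow, sq_abs]
  have hyle (i : Fin n) (hi : i ≠ i₀) : y i ≤ r + r⁻¹ := by
    rw [hrm, hyabs]
    have := hle i hi
    gcongr
  have hlim : Tendsto (fun k => Hseq q X (2 * k) / r ^ k) atTop
      (nhds (∑ i ∈ Finset.univ.erase i₀, -(if y i = r + r⁻¹ then (1 : ℝ) else 0))) := by
    simp only [Hseq_two_mul hq hreg hA hperm htop, Finset.sum_div]
    refine tendsto_finsetSum _ fun i hi => ?_
    have h2 : Tendsto (fun k : ℕ => 2 / r ^ k) atTop (nhds 0) :=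
      (tendsto_pow_atTop_atTop_of_one_lt hr).const_div_atTop 2
    have h3 : Tendsto (fun k : ℕ => (Polynomial.dickson 1 (1 : ℝ) k).eval (y i) / r ^ k) atTop
        (nhds (if y i = r + r⁻¹ then (1 : ℝ) else 0)) := by
      split_ifs with h
      · rw [h]
        exact tendsto_eval_dickson_div_pow_self hr
      · refine tendsto_eval_dickson_div_pow hr ?_
          (lt_of_le_of_ne (hyle i (Finset.ne_of_mem_erase hi)) h)
        have := sq_nonneg ((√(q : ℝ))⁻¹ * lam i)
        simp only [hy]
        linarith
    simpa only [sub_div, zero_sub] using h2.sub h3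
  have hc : ∑ i ∈ Finset.univ.erase i₀, -(if y i = r + r⁻¹ then (1 : ℝ) else 0) ≠ 0 := by
    refine (Finset.sum_neg' (fun i _ => ?_) ⟨i₁, ?_, ?_⟩).ne
    · split_ifs <;> norm_num
    · exact Finset.mem_erase.2 ⟨fun h => hi₁ (h ▸ hi₀), Finset.mem_univ _⟩
    · rw [if_pos (by rw [hyabs, ← hmu_eq, hrm])]
      norm_num
  have hratio := tendsto_succ_div_of_tendsto_div_pow hr0.ne' hc hlim
  have hinv := hratio.inv₀ hr0.ne'
  have hsum : √r + √r⁻¹ = m := by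
    have h1 := Real.sq_sqrt hr0.le
    have h2 := Real.sq_sqrt (inv_nonneg.2 hr0.le)
    have h3 : √r * √r⁻¹ = 1 := by
      rw [← Real.sqrt_mul hr0.le, mul_inv_cancel₀ hr0.ne', Real.sqrt_one]
    have h4 := Real.sqrt_nonneg r
    have h5 := Real.sqrt_nonneg r⁻¹
    rw [← sq_eq_sq₀ (by positivity) (by linarith)]
    nlinarith
  rw [← hsum]
  refine ((Real.continuous_sqrt.tendsto r).comp hratio).add
    (((Real.continuous_sqrt.tendsto r⁻¹).comp hinv).congr fun k => ?_)
  simp only [Function.comp_apply, inv_div, mul_add, mul_one]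
end
end

section
/- Let q ≥ 1 and n ≥ 2 be integers and let X be a connected (q+1)-regular simple undirected graph on n vertices. For every even integer k ≥ 2, trace(W^k) = n(q−1) + q^{k/2} · trace(T_k(q^{−1/2} A)), where T_k(q^{−1/2}A) denotes the evaluation of the polynomial T_k at the matrix q^{−1/2}A. -/
open Matrix Filter

noncomputable section

/-- The polynomials `T_k` as elements of `ℝ[X]`:
`T_0 = 2`, `T_1 = X`, `T_{k+1} = X·T_k − T_{k−1}`. -/
def Tpoly : ℕ → Polynomial ℝ
  | 0 => 2
  | 1 => Polynomial.X
  | (k + 2) => Polynomial.X * Tpoly (k + 1) - Tpoly k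

/-- The vertex-dart incidence matrix of starting points. -/
def startMatrix {n : ℕ} (X : SimpleGraph (Fin n)) [DecidableRel X.Adj] :
    Matrix (Fin n) X.Dart ℝ :=
  Matrix.of fun v e => if e.fst = v then 1 else 0

/-- The vertex-dart incidence matrix of end points. -/
def endMatrix {n : ℕ} (X : SimpleGraph (Fin n)) [DecidableRel X.Adj] :
    Matrix (Fin n) X.Dart ℝ :=
  Matrix.of fun v e => if e.snd = v then 1 else 0

/-- The permutation matrix of dart reversal. -/
def reversalMatrix {n : ℕ} (X : SimpleGraph (Fin n)) [DecidableRel X.Adj] :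
    Matrix X.Dart X.Dart ℝ :=
  Matrix.of fun e f => if f = e.symm then 1 else 0

section Incidence

variable {n : ℕ} (X : SimpleGraph (Fin n)) [DecidableRel X.Adj]

lemma reversalMatrix_transpose : (reversalMatrix X)ᵀ = reversalMatrix X := by
  ext e f
  simp only [reversalMatrix, Matrix.transpose_apply, Matrix.of_apply]
  exact if_congr ⟨fun h => by simp [h], fun h => by simp [h]⟩ rfl rfl

lemma reversalMatrix_mul_self : reversalMatrix X * reversalMatrix X = 1 := by
  nth_rw 2 [← reversalMatrix_transpose]
  ext e f
  simp [reversalMatrix, Matrix.mul_apply, Matrix.one_apply,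
    SimpleGraph.Dart.symm_involutive.injective.eq_iff, eq_comm]

lemma startMatrix_mul_reversalMatrix :
    startMatrix X * reversalMatrix X = endMatrix X := by
  rw [← reversalMatrix_transpose]
  ext v e
  simp [startMatrix, endMatrix, reversalMatrix, Matrix.mul_apply]

lemma endMatrix_mul_reversalMatrix :
    endMatrix X * reversalMatrix X = startMatrix X := by
  rw [← startMatrix_mul_reversalMatrix, Matrix.mul_assoc, reversalMatrix_mul_self,
    Matrix.mul_one]

lemma reversalMatrix_mul_endMatrix_transpose :
    reversalMatrix X * (endMatrix X)ᵀ = (startMatrix X)ᵀ := by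
  rw [← endMatrix_mul_reversalMatrix, Matrix.transpose_mul, reversalMatrix_transpose]

lemma hashimoto_eq_s5 :
    hashimoto X = (endMatrix X)ᵀ * startMatrix X - reversalMatrix X := by
  ext e f
  by_cases h1 : f = e.symm
  · simp [hashimoto, endMatrix, startMatrix, reversalMatrix, Matrix.mul_apply, h1]
  · simp [hashimoto, endMatrix, startMatrix, reversalMatrix, Matrix.mul_apply, h1, eq_comm]

lemma startMatrix_mul_endMatrix_transpose :
    startMatrix X * (endMatrix X)ᵀ = X.adjMatrix ℝ := by
  ext u v
  simp only [startMatrix, endMatrix, Matrix.mul_apply, Matrix.transpose_apply, Matrix.of_apply,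
    SimpleGraph.adjMatrix_apply]
  by_cases h : X.Adj u v
  · rw [if_pos h, Finset.sum_eq_single (⟨(u, v), h⟩ : X.Dart)]
    · simp
    · intro e _ he
      by_contra hne
      have h1 : e.fst = u ∧ e.snd = v := by
        by_contra hc
        apply hne
        by_cases h2 : e.fst = u <;> simp_all
      exact he (SimpleGraph.Dart.ext _ _ (Prod.ext h1.1 h1.2))
    · simp
  · rw [if_neg h]
    refine Finset.sum_eq_zero fun e _ => ?_
    by_cases h1 : e.fst = u
    · by_cases h2 : e.snd = v
      · exact absurd (h1 ▸ h2 ▸ e.adj) h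
      · simp [h2]
    · simp [h1]

lemma endMatrix_mul_startMatrix_transpose :
    endMatrix X * (startMatrix X)ᵀ = X.adjMatrix ℝ := by
  rw [← SimpleGraph.transpose_adjMatrix, ← startMatrix_mul_endMatrix_transpose,
    Matrix.transpose_mul, Matrix.transpose_transpose]


lemma reversalMatrix_mul_hashimoto :
    reversalMatrix X * hashimoto X = (startMatrix X)ᵀ * startMatrix X - 1 := by
  rw [hashimoto_eq_s5, Matrix.mul_sub, ← Matrix.mul_assoc, reversalMatrix_mul_endMatrix_transpose,
    reversalMatrix_mul_self]

lemma startMatrix_mul_hashimoto :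
    startMatrix X * hashimoto X = X.adjMatrix ℝ * startMatrix X - endMatrix X := by
  rw [hashimoto_eq_s5, Matrix.mul_sub, ← Matrix.mul_assoc, startMatrix_mul_endMatrix_transpose,
    startMatrix_mul_reversalMatrix]

lemma trace_hashimoto_pow_add_two (k : ℕ) :
    (hashimoto X ^ (k + 2)).trace = (hashimoto X ^ k).trace +
      (startMatrix X * hashimoto X ^ (k + 1) * (endMatrix X)ᵀ -
        startMatrix X * hashimoto X ^ k * (startMatrix X)ᵀ).trace := by
  have h1 : hashimoto X ^ (k + 2) = hashimoto X ^ (k + 1) * (endMatrix X)ᵀ * startMatrix X -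
      hashimoto X ^ (k + 1) * reversalMatrix X := by
    rw [pow_succ _ (k + 1), Matrix.mul_assoc, ← Matrix.mul_sub, ← hashimoto_eq_s5]
  have h2 : (hashimoto X ^ (k + 1) * reversalMatrix X).trace =
      (startMatrix X * hashimoto X ^ k * (startMatrix X)ᵀ).trace - (hashimoto X ^ k).trace := by
    rw [Matrix.trace_mul_comm, pow_succ', ← Matrix.mul_assoc, reversalMatrix_mul_hashimoto,
      Matrix.sub_mul, Matrix.one_mul, Matrix.trace_sub, Matrix.mul_assoc, Matrix.trace_mul_comm]
  rw [h1, Matrix.trace_sub, h2, Matrix.trace_sub, Matrix.trace_mul_comm, ← Matrix.mul_assoc]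
  ring

variable {X} {q : ℕ}

lemma startMatrix_mul_transpose_self (hreg : X.IsRegularOfDegree (q + 1)) :
    startMatrix X * (startMatrix X)ᵀ = ((q : ℝ) + 1) • 1 := by
  ext u v
  by_cases h : u = v
  · subst h
    have hcard := X.dart_fst_fiber_card_eq_degree u
    rw [hreg.degree_eq] at hcard
    simp only [startMatrix, Matrix.mul_apply, Matrix.transpose_apply, Matrix.of_apply,
      ← ite_and, mul_ite, mul_one, mul_zero, and_self, Finset.sum_boole, Matrix.smul_apply,
      Matrix.one_apply_eq, smul_eq_mul]
    exact_mod_cast hcard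
  · rw [Matrix.smul_apply, Matrix.one_apply_ne h, smul_zero, Matrix.mul_apply]
    refine Finset.sum_eq_zero fun e _ => ?_
    by_cases h1 : e.fst = u
    · simp [startMatrix, h1, h]
    · simp [startMatrix, h1]

lemma endMatrix_mul_transpose_self (hreg : X.IsRegularOfDegree (q + 1)) :
    endMatrix X * (endMatrix X)ᵀ = ((q : ℝ) + 1) • 1 := by
  rw [← startMatrix_mul_transpose_self hreg, ← reversalMatrix_mul_endMatrix_transpose,
    ← Matrix.mul_assoc, startMatrix_mul_reversalMatrix]

lemma endMatrix_mul_hashimoto (hreg : X.IsRegularOfDegree (q + 1)) :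
    endMatrix X * hashimoto X = (q : ℝ) • startMatrix X := by
  rw [hashimoto_eq_s5, Matrix.mul_sub, ← Matrix.mul_assoc, endMatrix_mul_transpose_self hreg,
    endMatrix_mul_reversalMatrix, Matrix.smul_mul, Matrix.one_mul, add_smul, one_smul,
    add_sub_cancel_right]

lemma startMatrix_mul_hashimoto_pow_add_two (hreg : X.IsRegularOfDegree (q + 1)) (k : ℕ) :
    startMatrix X * hashimoto X ^ (k + 2) =
      X.adjMatrix ℝ * (startMatrix X * hashimoto X ^ (k + 1)) -
        (q : ℝ) • (startMatrix X * hashimoto X ^ k) := by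
  rw [pow_succ' _ (k + 1), ← Matrix.mul_assoc, startMatrix_mul_hashimoto, Matrix.sub_mul,
    Matrix.mul_assoc, pow_succ' _ k, ← Matrix.mul_assoc (endMatrix X),
    endMatrix_mul_hashimoto hreg, Matrix.smul_mul]

lemma trace_hashimoto_pow_zero (hreg : X.IsRegularOfDegree (q + 1)) :
    (hashimoto X ^ 0).trace = (n : ℝ) * (q + 1) := by
  rw [pow_zero, Matrix.trace_one, X.dart_card_eq_sum_degrees]
  simp [hreg.degree_eq]

end Incidence

/-- `√q ^ k • T_k(A / √q)`, defined by its recurrence. -/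
def scaledChebyshev {n : ℕ} (q : ℝ) (A : Matrix (Fin n) (Fin n) ℝ) :
    ℕ → Matrix (Fin n) (Fin n) ℝ
  | 0 => (2 : ℝ) • 1
  | 1 => A
  | (k + 2) => A * scaledChebyshev q A (k + 1) - q • scaledChebyshev q A k

lemma smul_aeval_Tpoly {n : ℕ} {s : ℝ} (hs : s ≠ 0) (A : Matrix (Fin n) (Fin n) ℝ) (k : ℕ) :
    s ^ k • Polynomial.aeval (s⁻¹ • A) (Tpoly k) = scaledChebyshev (s ^ 2) A k := by
  induction k using Nat.twoStepInduction with
  | zero =>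
    rw [pow_zero, one_smul, Tpoly, map_ofNat, scaledChebyshev, two_smul, one_add_one_eq_two]
  | one => simp [Tpoly, scaledChebyshev, hs]
  | more k ih0 ih1 =>
    rw [scaledChebyshev, ← ih0, ← ih1, Tpoly, map_sub, map_mul, Polynomial.aeval_X, smul_sub,
      Matrix.smul_mul, Matrix.mul_smul, smul_smul, smul_smul]
    congr 2
    · field_simp
      ring
    · ring

lemma startMatrix_hashimoto_pow_sub_eq {n q : ℕ} {X : SimpleGraph (Fin n)}
    [DecidableRel X.Adj] (hreg : X.IsRegularOfDegree (q + 1)) (k : ℕ) :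
    startMatrix X * hashimoto X ^ (k + 1) * (endMatrix X)ᵀ -
        startMatrix X * hashimoto X ^ k * (startMatrix X)ᵀ =
      scaledChebyshev q (X.adjMatrix ℝ) (k + 2) - scaledChebyshev q (X.adjMatrix ℝ) k := by
  have h1 : startMatrix X * hashimoto X * (endMatrix X)ᵀ =
      X.adjMatrix ℝ * X.adjMatrix ℝ - ((q : ℝ) + 1) • 1 := by
    rw [startMatrix_mul_hashimoto, Matrix.sub_mul, Matrix.mul_assoc,
      startMatrix_mul_endMatrix_transpose, endMatrix_mul_transpose_self hreg]
  induction k using Nat.twoStepInduction with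
  | zero =>
    simp only [zero_add, pow_one, pow_zero, Matrix.mul_one, h1,
      startMatrix_mul_transpose_self hreg, scaledChebyshev]
    module
  | one =>
    rw [startMatrix_mul_hashimoto_pow_add_two hreg 0]
    simp only [zero_add, pow_one, pow_zero, Matrix.mul_one, Matrix.sub_mul, Matrix.smul_mul,
      Matrix.mul_assoc (X.adjMatrix ℝ), h1, startMatrix_mul_endMatrix_transpose]
    rw [startMatrix_mul_hashimoto, Matrix.sub_mul, Matrix.mul_assoc,
      startMatrix_mul_transpose_self hreg, endMatrix_mul_startMatrix_transpose]
    simp only [scaledChebyshev, Matrix.mul_sub, Matrix.mul_smul, Matrix.mul_one]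
    module
  | more k ih0 ih1 =>
    have hrec (Z : Matrix X.Dart (Fin n) ℝ) (j : ℕ) :
        startMatrix X * hashimoto X ^ (j + 2) * Z =
          X.adjMatrix ℝ * (startMatrix X * hashimoto X ^ (j + 1) * Z) -
            (q : ℝ) • (startMatrix X * hashimoto X ^ j * Z) := by
      rw [startMatrix_mul_hashimoto_pow_add_two hreg, Matrix.sub_mul, Matrix.smul_mul,
        Matrix.mul_assoc (X.adjMatrix ℝ)]
    rw [sub_eq_iff_eq_add] at ih0 ih1
    let C := scaledChebyshev (q : ℝ) (X.adjMatrix ℝ)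
    have hC : C (k + 2 + 2) - C (k + 2) =
        (X.adjMatrix ℝ * C (k + 1 + 2) - (q : ℝ) • C (k + 2)) -
          (X.adjMatrix ℝ * C (k + 1) - (q : ℝ) • C k) := rfl
    rw [hrec _ (k + 1), hrec (startMatrix X)ᵀ k, ih0, ih1, hC]
    simp only [Matrix.mul_add, Matrix.mul_sub]
    module

lemma trace_hashimoto_pow_two_mul {n q : ℕ} {X : SimpleGraph (Fin n)}
    [DecidableRel X.Adj] (hreg : X.IsRegularOfDegree (q + 1)) (m : ℕ) :
    (hashimoto X ^ (2 * m)).trace =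
      (n : ℝ) * ((q : ℝ) - 1) + (scaledChebyshev q (X.adjMatrix ℝ) (2 * m)).trace := by
  induction m with
  | zero =>
    rw [Nat.mul_zero, trace_hashimoto_pow_zero hreg, scaledChebyshev]
    simp only [Matrix.trace_smul, Matrix.trace_one, Fintype.card_fin, smul_eq_mul]
    ring
  | succ m ih =>
    rw [Nat.mul_succ, trace_hashimoto_pow_add_two, startMatrix_hashimoto_pow_sub_eq hreg, ih,
      Matrix.trace_sub]
    ring

theorem trace_Wk_even {q n : ℕ} (hq : 1 ≤ q) (hn : 2 ≤ n)
    (X : SimpleGraph (Fin n)) [DecidableRel X.Adj]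
    (hconn : X.Connected) (hreg : X.IsRegularOfDegree (q + 1))
    (k : ℕ) (hk : 2 ≤ k) (hke : Even k) :
    (hashimoto X ^ k).trace =
      (n : ℝ) * ((q : ℝ) - 1) +
        Real.sqrt q ^ k *
          (Polynomial.aeval ((Real.sqrt q)⁻¹ • X.adjMatrix ℝ) (Tpoly k)).trace := by
  obtain ⟨m, rfl⟩ := hke
  have hs : Real.sqrt q ≠ 0 := (Real.sqrt_pos.2 (by exact_mod_cast hq)).ne'
  rw [← smul_eq_mul (Real.sqrt q ^ (m + m)), ← Matrix.trace_smul, smul_aeval_Tpoly hs,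
    Real.sq_sqrt (Nat.cast_nonneg q), ← two_mul, trace_hashimoto_pow_two_mul hreg]
end
end

section
/- Let S be a nonempty finite multiset of real numbers. If there is an even integer k ≥ 2 such that (1/(2|S|)) Σ_{s∈S} T_k(s) ≤ 1, then |s| ≤ 1 + (4|S| − 3)^{1/k} for all s ∈ S. -/
noncomputable section

/-- The polynomials `T_k`: `T_0(x) = 2`, `T_1(x) = x`, `T_{k+1}(x) = x·T_k(x) − T_{k−1}(x)`. -/
def Tk : ℕ → ℝ → ℝ
  | 0, _ => 2
  | 1, x => x
  | (k + 2), x => x * Tk (k + 1) x - Tk k x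

theorem Tk_add_two (k : ℕ) (x : ℝ) : Tk (k + 2) x = x * Tk (k + 1) x - Tk k x := rfl

theorem Tk_add_inv (t : ℝ) (ht : t ≠ 0) (k : ℕ) :
    Tk k (t + t⁻¹) = t ^ k + t⁻¹ ^ k := by
  induction k using Nat.twoStepInduction with
  | zero => norm_num [Tk]
  | one => simp [Tk]
  | more k h₀ h₁ =>
    have h : t * t⁻¹ = 1 := mul_inv_cancel₀ ht
    rw [Tk_add_two, h₀, h₁]
    linear_combination (t ^ k + t⁻¹ ^ k) * h

theorem Tk_neg (x : ℝ) (k : ℕ) : Tk k (-x) = (-1) ^ k * Tk k x := by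
  induction k using Nat.twoStepInduction with
  | zero => simp [Tk]
  | one => simp [Tk]
  | more k h₀ h₁ =>
    rw [Tk_add_two, Tk_add_two, h₀, h₁]
    ring

theorem Tk_abs {k : ℕ} (hk : Even k) (x : ℝ) : Tk k |x| = Tk k x := by
  rcases abs_choice x with h | h
  · rw [h]
  · rw [h, Tk_neg, hk.neg_one_pow, one_mul]

theorem Tk_mul_self_and_mul_succ (x : ℝ) (m : ℕ) :
    Tk m x ^ 2 = Tk (2 * m) x + 2 ∧ Tk m x * Tk (m + 1) x = Tk (2 * m + 1) x + x ∧
      Tk (m + 1) x ^ 2 = Tk (2 * m + 2) x + 2 := by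
  induction m with
  | zero => norm_num [Tk]; constructor <;> ring
  | succ m ih =>
    obtain ⟨h₀, h₁, h₂⟩ := ih
    have e₂ := Tk_add_two (2 * m) x
    have e₃ := Tk_add_two (2 * m + 1) x
    have e₄ := Tk_add_two (2 * m + 2) x
    have hm := Tk_add_two m x
    have h₃ : Tk (m + 1) x * Tk (m + 2) x = Tk (2 * m + 3) x + x := by
      rw [hm]
      linear_combination x * h₂ - h₁ - e₃
    refine ⟨h₂, h₃, ?_⟩
    change Tk (m + 2) x ^ 2 = Tk (2 * m + 4) x + 2
    linear_combination x * h₃ - x * h₁ + h₀ - e₄ + e₂ + (Tk (m + 2) x - Tk m x) * hm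

theorem neg_two_le_Tk {k : ℕ} (hk : Even k) (x : ℝ) : -2 ≤ Tk k x := by
  obtain ⟨m, rfl⟩ := hk
  have h := (Tk_mul_self_and_mul_succ x m).1
  rw [two_mul] at h
  linarith [sq_nonneg (Tk m x)]

theorem add_sub_one_pow_add_one_le {a b : ℝ} (ha : 1 ≤ a) (hb₀ : 0 ≤ b) (hb : b ≤ 1)
    (hab : 1 ≤ a + b) (k : ℕ) : (a + b - 1) ^ k + 1 ≤ a ^ k + b ^ k := by
  induction k with
  | zero => simp
  | succ k ih =>
    have h₁ := mul_nonneg (sub_nonneg.2 hb) (sub_nonneg.2 (one_le_pow₀ ha (n := k)))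
    have h₂ := mul_nonneg (sub_nonneg.2 ha) (sub_nonneg.2 (pow_le_one₀ hb₀ hb (n := k)))
    have h₃ := mul_le_mul_of_nonneg_left ih (sub_nonneg.2 hab)
    rw [pow_succ, pow_succ, pow_succ]
    linarith

theorem exists_add_inv_eq_s7 {x : ℝ} (hx : 2 ≤ x) : ∃ t : ℝ, 1 ≤ t ∧ t + t⁻¹ = x := by
  have h := Real.sq_sqrt (show 0 ≤ x ^ 2 - 4 by nlinarith)
  have h₀ := Real.sqrt_nonneg (x ^ 2 - 4)
  refine ⟨(x + √(x ^ 2 - 4)) / 2, by linarith, ?_⟩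
  rw [inv_eq_of_mul_eq_one_right (b := (x - √(x ^ 2 - 4)) / 2) (by linear_combination -h / 4)]
  ring

theorem sub_one_pow_add_one_le_Tk {x : ℝ} (hx : 2 ≤ x) (k : ℕ) :
    (x - 1) ^ k + 1 ≤ Tk k x := by
  obtain ⟨t, ht, rfl⟩ := exists_add_inv_eq_s7 hx
  have ht₀ : 0 < t := by linarith
  rw [Tk_add_inv t ht₀.ne']
  exact add_sub_one_pow_add_one_le ht (by positivity) (inv_le_one_of_one_le₀ ht) (by linarith) k

theorem abs_le_of_multiset_Tk_avg_le (S : Multiset ℝ) (hS : S ≠ 0)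
    (k : ℕ) (hk : 2 ≤ k) (hke : Even k)
    (hsum : (1 / (2 * (Multiset.card S : ℝ))) * (S.map (Tk k)).sum ≤ 1) :
    ∀ s ∈ S, |s| ≤ 1 + (4 * (Multiset.card S : ℝ) - 3) ^ ((k : ℝ))⁻¹ := by
  intro s hs
  have hcard : (1 : ℝ) ≤ Multiset.card S := by
    exact_mod_cast Multiset.card_pos.2 hS
  rcases le_total |s| 2 with h | h
  · have := Real.one_le_rpow (show 1 ≤ 4 * (Multiset.card S : ℝ) - 3 by linarith)
      (show (0 : ℝ) ≤ (k : ℝ)⁻¹ by positivity)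
    linarith
  · rw [one_div, inv_mul_le_iff₀ (by linarith), mul_one] at hsum
    obtain ⟨R, rfl⟩ := Multiset.exists_cons_of_mem hs
    have hR : Multiset.card R • (-2 : ℝ) ≤ (R.map (Tk k)).sum := by
      have := Multiset.card_nsmul_le_sum (s := R.map (Tk k)) (a := (-2 : ℝ)) (by
        intro y hy
        obtain ⟨x, -, rfl⟩ := Multiset.mem_map.1 hy
        exact neg_two_le_Tk hke x)
      rwa [Multiset.card_map] at this
    rw [nsmul_eq_mul] at hR
    have hpow := sub_one_pow_add_one_le_Tk h k
    rw [Tk_abs hke] at hpow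
    rw [Multiset.map_cons, Multiset.sum_cons] at hsum
    rw [Multiset.card_cons] at hsum hcard ⊢
    push_cast at hsum hcard ⊢
    have hroot : |s| - 1 ≤ (4 * ((Multiset.card R : ℝ) + 1) - 3) ^ ((k : ℝ))⁻¹ := by
      rw [← Real.pow_rpow_inv_natCast (show 0 ≤ |s| - 1 by linarith) (show k ≠ 0 by omega)]
      refine Real.rpow_le_rpow (pow_nonneg (by linarith) k) ?_ (by positivity)
      linarith
    linarith
end
end
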